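/- arXiv:2109.06442 — 9 statements merged into one kernel-verified Lean document; each statement's English description precedes it below -/
import Mathlib

section
/- Let μ be a (1/α)-entropically independent probability distribution on k-subsets of [n] with α ∈ (0,1], and suppose that every marginal satisfies P_μ[i ∈ S] ≤ Ck/n for some constant C > 0. Let ε ∈ (0, 1/4], and let t be an integer with 2k < t ≤ n such that (2Ck²/n)·((n − 2k)/(t − 2k))^{1/α} ≤ log(1/(1 − ε)). Then for every S₀ with |S₀| = k and μ(S₀) > 0, the output S₁ of one step of the Markov chain M^t_μ started at S₀ satisfies P[S₁ = S] ≥ (1 − ε)·μ(S) for every k-subset S of [n]. -/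
open Finset

lemma aux_rec (n t s : ℕ) (ht : t ≤ n) (hs : s < n) :
    ((n : ℝ) - s) * ((n - (s + 1)).choose (n - t) : ℝ) =
      ((t : ℝ) - s) * ((n - s).choose (n - t) : ℝ) := by
  obtain ⟨m, rfl⟩ : ∃ m, n = s + 1 + m := ⟨n - (s + 1), by omega⟩
  have e1 : s + 1 + m - (s + 1) = m := by omega
  have e2 : s + 1 + m - s = m + 1 := by omega
  rw [e1, e2]
  obtain ⟨d, hd⟩ : ∃ d, s + 1 + m = t + d := ⟨s + 1 + m - t, by omega⟩
  have e3 : s + 1 + m - t = d := by omega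
  rw [e3]
  have hd' : (s : ℝ) + 1 + m = t + d := by exact_mod_cast hd
  have h := Nat.add_one_mul_choose_eq m d
  have h2 := Nat.choose_succ_succ m d
  have h' : ((m : ℝ) + 1) * (m.choose d) = ((m + 1).choose (d + 1)) * (d + 1) := by
    exact_mod_cast h
  have h2' : (((m + 1).choose (d + 1) : ℕ) : ℝ) = m.choose d + m.choose (d + 1) := by
    exact_mod_cast h2
  rcases d with _ | d
  · simp at *
    linarith
  · have h3 := Nat.choose_succ_succ m d
    have h3' : (((m + 1).choose (d + 1) : ℕ) : ℝ) = m.choose d + m.choose (d + 1) := by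
      exact_mod_cast h3
    have h4 := Nat.add_one_mul_choose_eq m d
    have h4' : ((m : ℝ) + 1) * (m.choose d) = ((m + 1).choose (d + 1)) * (d + 1) := by
      exact_mod_cast h4
    have e5 : (t : ℝ) - s = m - d := by push_cast at hd'; linarith
    rw [e5]
    push_cast
    have : (m.choose (d + 1) : ℝ) = ((m + 1).choose (d + 1) : ℕ) - m.choose d := by
      rw [h3']; ring
    rw [this]
    linear_combination (-1 : ℝ) * h4'

lemma aux_logconc (n t k r : ℕ) (ht : t ≤ n) (hkr : k ≤ r) (m : ℕ) (hm : r + m ≤ n) :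
    ((n - k).choose (n - t) : ℝ) * ((n - (r + m)).choose (n - t) : ℝ) ≤
      ((n - r).choose (n - t) : ℝ) * ((n - (k + m)).choose (n - t) : ℝ) := by
  induction m with
  | zero => simp [mul_comm]
  | succ m ih =>
    have ih := ih (by omega)
    by_cases htm : r + (m + 1) ≤ t
    · have h1 := aux_rec n t (r + m) ht (by omega)
      have h2 := aux_rec n t (k + m) ht (by omega)
      rw [← add_assoc, ← add_assoc]
      have p1 : (r : ℝ) + m + 1 ≤ n := by exact_mod_cast hm
      have p2 : (k : ℝ) ≤ r := by exact_mod_cast hkr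
      have p3 : (r : ℝ) + m + 1 ≤ t := by exact_mod_cast htm
      have p4 : (t : ℝ) ≤ n := by exact_mod_cast ht
      push_cast at h1 h2
      have q1 : (0 : ℝ) < n - (r + m) := by linarith
      have q2 : (0 : ℝ) < n - (k + m) := by linarith
      have h1' : ((n - (r + m + 1)).choose (n - t) : ℝ) =
          (t - (r + m)) / (n - (r + m)) * ((n - (r + m)).choose (n - t) : ℝ) := by
        field_simp; linarith
      have h2' : ((n - (k + m + 1)).choose (n - t) : ℝ) =
          (t - (k + m)) / (n - (k + m)) * ((n - (k + m)).choose (n - t) : ℝ) := by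
        field_simp; linarith
      rw [h1', h2']
      have hq : ((t : ℝ) - (r + m)) / (n - (r + m)) ≤ (t - (k + m)) / (n - (k + m)) := by
        rw [div_le_div_iff₀ q1 q2]
        nlinarith
      have hq0 : 0 ≤ ((t : ℝ) - (k + m)) / (n - (k + m)) := by
        apply div_nonneg <;> linarith
      calc _ = ((t : ℝ) - (r + m)) / (n - (r + m)) *
            (((n - k).choose (n - t) : ℝ) * ((n - (r + m)).choose (n - t) : ℝ)) := by ring
        _ ≤ (t - (k + m)) / (n - (k + m)) *
            (((n - r).choose (n - t) : ℝ) * ((n - (k + m)).choose (n - t) : ℝ)) :=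
            mul_le_mul hq ih (by positivity) hq0
        _ = _ := by ring
    · have : (n - (r + (m + 1))).choose (n - t) = 0 := Nat.choose_eq_zero_of_lt (by omega)
      rw [this]
      simp only [Nat.cast_zero, mul_zero]
      positivity

lemma aux_step (n t k : ℕ) (ht : t ≤ n) (hkt : 2 * k < t) (s : ℕ) (hs : s < 2 * k) :
    ((n - s).choose (n - t) : ℝ) ≤
      (((n : ℝ) - 2 * k) / ((t : ℝ) - 2 * k)) * ((n - (s + 1)).choose (n - t) : ℝ) := by
  have h := aux_rec n t s ht (by omega)
  have p1 : (2 : ℝ) * k < t := by exact_mod_cast hkt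
  have p2 : (s : ℝ) < 2 * k := by exact_mod_cast hs
  have p4 : (t : ℝ) ≤ n := by exact_mod_cast ht
  have q0 : (0 : ℝ) < t - s := by linarith
  have q1 : (0 : ℝ) < t - 2 * k := by linarith
  have : ((n - s).choose (n - t) : ℝ) =
      (n - s) / (t - s) * ((n - (s + 1)).choose (n - t) : ℝ) := by
    field_simp; linarith
  rw [this]
  apply mul_le_mul_of_nonneg_right _ (by positivity)
  rw [div_le_div_iff₀ q0 q1]
  nlinarith

lemma aux_pow (n t k : ℕ) (ht : t ≤ n) (hkt : 2 * k < t) (j : ℕ) (hj : j ≤ 2 * k) :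
    ((n - (2 * k - j)).choose (n - t) : ℝ) ≤
      (((n : ℝ) - 2 * k) / ((t : ℝ) - 2 * k)) ^ j * ((n - 2 * k).choose (n - t) : ℝ) := by
  have p1 : (2 : ℝ) * k < t := by exact_mod_cast hkt
  have p4 : (t : ℝ) ≤ n := by exact_mod_cast ht
  have hl : 0 ≤ (((n : ℝ) - 2 * k) / ((t : ℝ) - 2 * k)) := by
    apply div_nonneg <;> linarith
  induction j with
  | zero => simp
  | succ j ih =>
    have ih := ih (by omega)
    have h := aux_step n t k ht hkt (2 * k - (j + 1)) (by omega)
    have e : 2 * k - (j + 1) + 1 = 2 * k - j := by omega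
    rw [e] at h
    refine h.trans ?_
    rw [pow_succ', mul_assoc]
    exact mul_le_mul_of_nonneg_left ih hl

lemma aux_main (n t k r m : ℕ) (ht : t ≤ n) (hkt : 2 * k < t) (hkr : k ≤ r) (hr : r ≤ 2 * k)
    (hm : m ≤ k) (hrm : r + m ≤ n) :
    ((n - k).choose (n - t) : ℝ) * ((n - (r + m)).choose (n - t) : ℝ) ≤
      ((n - r).choose (n - t) : ℝ) ^ 2 *
        (((n : ℝ) - 2 * k) / ((t : ℝ) - 2 * k)) ^ (k - m) := by
  refine (aux_logconc n t k r ht hkr m hrm).trans ?_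
  have h := aux_pow n t k ht hkt (k - m) (by omega)
  have e : 2 * k - (k - m) = k + m := by omega
  rw [e] at h
  have p1 : (2 : ℝ) * k < t := by exact_mod_cast hkt
  have p4 : (t : ℝ) ≤ n := by exact_mod_cast ht
  have hl : 0 ≤ (((n : ℝ) - 2 * k) / ((t : ℝ) - 2 * k)) := by
    apply div_nonneg <;> linarith
  have h2 : ((n - 2 * k).choose (n - t) : ℝ) ≤ ((n - r).choose (n - t) : ℝ) := by
    exact_mod_cast Nat.choose_le_choose _ (by omega)
  rw [pow_two, mul_assoc]
  apply mul_le_mul_of_nonneg_left _ (by positivity)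
  rw [mul_comm]
  exact h.trans (mul_le_mul_of_nonneg_left h2 (by positivity))

lemma aux_count (n k t : ℕ) (hkt : k ≤ t) (ht : t ≤ n) (S₀ X : Finset (Fin n))
    (h0 : S₀.card = k) (hX : S₀ ⊆ X) :
    ((powersetCard (t - k) (univ \ S₀)).filter (fun T => X ⊆ S₀ ∪ T)).card =
      (n - X.card).choose (n - t) := by
  have hc : (Xᶜ).card = n - X.card := by rw [card_compl, Fintype.card_fin]
  rw [← hc, ← card_powersetCard]
  apply card_nbij' (fun T => (S₀ ∪ T)ᶜ) (fun V => Vᶜ \ S₀)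
  · intro T hT
    simp only [mem_coe, mem_filter, mem_powersetCard] at hT
    obtain ⟨⟨h1, h2⟩, h3⟩ := hT
    simp only [mem_coe, mem_powersetCard]
    refine ⟨compl_subset_compl.2 h3, ?_⟩
    have hd : Disjoint S₀ T := by
      rw [Finset.disjoint_left]; intro a ha hb
      have := h1 hb
      simp at this; exact this ha
    rw [card_compl, Fintype.card_fin, card_union_of_disjoint hd, h0, h2]
    omega
  · intro V hV
    simp only [mem_coe, mem_powersetCard] at hV
    obtain ⟨h1, h2⟩ := hV
    have h3 : X ⊆ Vᶜ := by
      rw [← compl_compl X]; exact compl_subset_compl.2 h1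
    simp only [mem_coe, mem_filter, mem_powersetCard]
    refine ⟨⟨?_, ?_⟩, ?_⟩
    · intro a; simp
    · rw [card_sdiff_of_subset (hX.trans h3), card_compl, Fintype.card_fin, h0, h2]
      omega
    · rw [union_sdiff_of_subset (hX.trans h3)]; exact h3
  · intro T hT
    simp only [mem_coe, mem_filter, mem_powersetCard] at hT
    obtain ⟨⟨h1, h2⟩, h3⟩ := hT
    ext a
    have := @h1 a
    simp at this ⊢
    tauto
  · intro V hV
    simp only [mem_coe, mem_powersetCard] at hV
    obtain ⟨h1, h2⟩ := hV
    ext a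
    have h3 := @h1 a
    have h4 := @hX a
    simp at h3 h4 ⊢
    tauto

/-- One step of the Markov chain `M^t_μ` from `S₀` gives each `k`-subset `S`
probability at least `(1-ε)·μ(S)`, provided `μ` is `(1/α)`-entropically independent, has
marginals bounded by `Ck/n`, and `t` satisfies the stated condition. -/
theorem one_step_lower_bound
    (n k t : ℕ) (hk : 0 < k) (hkn : k ≤ n)
    (μ : Finset (Fin n) → ℝ)
    (hμ0 : ∀ S, 0 ≤ μ S)
    (hμcard : ∀ S : Finset (Fin n), S.card ≠ k → μ S = 0)
    (hμ1 : ∑ S : Finset (Fin n), μ S = 1)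
    (α : ℝ) (hα0 : 0 < α) (hα1 : α ≤ 1)
    -- (1/α)-entropic independence of μ
    (hEI : ∀ z : Fin n → ℝ, (∀ i, 0 ≤ z i) →
      (∑ S : Finset (Fin n), μ S * ∏ i ∈ S, z i ^ α) ^ ((1 : ℝ) / (k * α)) ≤
        ∑ i : Fin n,
          ((∑ S ∈ Finset.univ.filter (fun S : Finset (Fin n) => i ∈ S), μ S) / k) * z i)
    (C : ℝ) (hC : 0 < C)
    -- all marginals are at most Ck/n
    (hmarg : ∀ i : Fin n,
      (∑ S ∈ Finset.univ.filter (fun S : Finset (Fin n) => i ∈ S), μ S) ≤ C * k / n)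
    (ε : ℝ) (hε0 : 0 < ε) (hε1 : ε ≤ 1 / 4)
    (ht1 : 2 * k < t) (ht2 : t ≤ n)
    (hcond : (2 * C * (k : ℝ) ^ 2 / n) *
        (((n : ℝ) - 2 * k) / ((t : ℝ) - 2 * k)) ^ ((1 : ℝ) / α) ≤ Real.log (1 / (1 - ε)))
    (S₀ : Finset (Fin n)) (hS₀card : S₀.card = k) (hS₀pos : 0 < μ S₀) :
    ∀ S : Finset (Fin n), S.card = k →
      (1 - ε) * μ S ≤
        (1 / (Nat.choose (n - k) (t - k) : ℝ)) *
          ∑ T ∈ Finset.powersetCard (t - k) (Finset.univ \ S₀),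
            (if S ⊆ S₀ ∪ T then
              μ S / (∑ S' ∈ Finset.powersetCard k (S₀ ∪ T), μ S') else 0) := by
  intro S hS
  have hn : 0 < n := by omega
  have hnR : (0 : ℝ) < n := by exact_mod_cast hn
  have hkR : (0 : ℝ) < k := by exact_mod_cast hk
  have p1 : (2 : ℝ) * k < t := by exact_mod_cast ht1
  have p4 : (t : ℝ) ≤ n := by exact_mod_cast ht2
  set l : ℝ := ((n : ℝ) - 2 * k) / ((t : ℝ) - 2 * k) with hl
  have hl1 : 1 ≤ l := by
    rw [hl, le_div_iff₀ (by linarith)]; linarith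
  have hl0 : 0 < l := by linarith
  set R := S₀ ∪ S with hR
  have hR0 : S₀ ⊆ R := subset_union_left
  have hRk : k ≤ R.card := hS₀card ▸ card_le_card hR0
  have hR2 : R.card ≤ 2 * k := by
    have := card_union_le S₀ S
    rw [← hR] at this; omega
  -- the entropic independence bound
  have hg : ∑ S' : Finset (Fin n), μ S' * l ^ (S' ∩ R).card ≤ 1 / (1 - ε) := by
    have hz := hEI (fun i => if i ∈ R then l ^ ((1 : ℝ) / α) else 1) (by
      intro i; split_ifs <;> positivity)
    have hprod : ∀ S' : Finset (Fin n),
        (∏ i ∈ S', (if i ∈ R then l ^ ((1 : ℝ) / α) else 1) ^ α) = l ^ (S' ∩ R).card := by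
      intro S'
      have : ∀ i ∈ S', (if i ∈ R then l ^ ((1 : ℝ) / α) else 1) ^ α =
          if i ∈ R then l else 1 := by
        intro i _
        split_ifs
        · rw [← Real.rpow_mul hl0.le, one_div, inv_mul_cancel₀ hα0.ne', Real.rpow_one]
        · exact Real.one_rpow _
      rw [prod_congr rfl this, prod_ite_mem, prod_const]
    simp only [hprod] at hz
    set g := ∑ S' : Finset (Fin n), μ S' * l ^ (S' ∩ R).card with hgdef
    have hg0 : 0 ≤ g := sum_nonneg fun S' _ => mul_nonneg (hμ0 S') (by positivity)
    set q : Fin n → ℝ := fun i =>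
      ∑ S ∈ Finset.univ.filter (fun S : Finset (Fin n) => i ∈ S), μ S with hq
    have hq0 : ∀ i, 0 ≤ q i := fun i => sum_nonneg fun S' _ => hμ0 S'
    have hqsum : ∑ i, q i = k := by
      simp only [hq, sum_filter]
      rw [sum_comm]
      have : ∀ S' : Finset (Fin n), (∑ i : Fin n, if i ∈ S' then μ S' else 0) = k * μ S' := by
        intro S'
        rw [sum_ite_mem, univ_inter, sum_const, nsmul_eq_mul]
        by_cases h : S'.card = k
        · rw [h]
        · rw [hμcard S' h]; simp
      rw [sum_congr rfl fun S' _ => this S', ← mul_sum, hμ1, mul_one]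
    set x := 2 * C * (k : ℝ) / n * l ^ ((1 : ℝ) / α) with hx
    have hB : (∑ i : Fin n, q i / k * (if i ∈ R then l ^ ((1 : ℝ) / α) else 1)) ≤ x + 1 := by
      have h1 : (∑ i : Fin n, q i / k * (if i ∈ R then l ^ ((1 : ℝ) / α) else 1)) ≤
          ∑ i : Fin n, ((if i ∈ R then C / n * l ^ ((1 : ℝ) / α) else 0) + q i / k) := by
        apply sum_le_sum
        intro i _
        have hqk : 0 ≤ q i / k := div_nonneg (hq0 i) hkR.le
        split_ifs
        · have h2 : q i / k ≤ C / n := by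
            rw [div_le_iff₀ hkR]
            refine (hmarg i).trans (le_of_eq ?_)
            ring
          have := mul_le_mul_of_nonneg_right h2 (by positivity : 0 ≤ l ^ ((1 : ℝ) / α))
          linarith
        · linarith
      refine h1.trans ?_
      rw [sum_add_distrib, ← sum_div, hqsum, div_self hkR.ne', sum_ite_mem, univ_inter,
        sum_const, nsmul_eq_mul]
      have : (R.card : ℝ) ≤ 2 * k := by exact_mod_cast hR2
      have h3 := mul_le_mul_of_nonneg_right this
        (by positivity : 0 ≤ C / n * l ^ ((1 : ℝ) / α))
      have h4 : 2 * (k : ℝ) * (C / n * l ^ ((1 : ℝ) / α)) = x := by rw [hx]; ring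
      linarith
    have hfin : g ^ ((1 : ℝ) / (k * α)) ≤ Real.exp x :=
      (hz.trans hB).trans (Real.add_one_le_exp x)
    have hka : 0 < (k : ℝ) * α := by positivity
    have h5 := Real.rpow_le_rpow (by positivity) hfin hka.le
    rw [← Real.rpow_mul hg0, one_div, inv_mul_cancel₀ hka.ne', Real.rpow_one,
      ← Real.exp_mul] at h5
    refine h5.trans ?_
    have hx0 : 0 ≤ x := by positivity
    have h6 : x * (k * α) ≤ Real.log (1 / (1 - ε)) := by
      refine le_trans ?_ hcond
      have h7 : 2 * C * (k : ℝ) ^ 2 / n * l ^ ((1 : ℝ) / α) = x * k := by rw [hx]; ring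
      rw [h7, ← mul_assoc]
      exact mul_le_of_le_one_right (by positivity) hα1
    calc _ ≤ Real.exp (Real.log (1 / (1 - ε))) := Real.exp_le_exp.2 h6
      _ = _ := Real.exp_log (by apply one_div_pos.2; linarith)
  set P := powersetCard (t - k) (univ \ S₀) with hP
  set F := P.filter (fun T => S ⊆ S₀ ∪ T) with hF
  set w : Finset (Fin n) → ℝ := fun T => ∑ S' ∈ Finset.powersetCard k (S₀ ∪ T), μ S' with hw
  have hw0 : ∀ T, 0 < w T := by
    intro T
    have h1 : S₀ ∈ Finset.powersetCard k (S₀ ∪ T) :=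
      mem_powersetCard.2 ⟨subset_union_left, hS₀card⟩
    exact hS₀pos.trans_le (single_le_sum (f := μ) (fun S' _ => hμ0 S') h1)
  have hsumeq : (∑ T ∈ P, (if S ⊆ S₀ ∪ T then μ S / w T else 0)) =
      μ S * ∑ T ∈ F, 1 / w T := by
    rw [hF, ← sum_filter, mul_sum]
    apply sum_congr rfl
    intro T _
    ring
  have hFR : ∀ X : Finset (Fin n), F.filter (fun T => X ⊆ S₀ ∪ T) =
      P.filter (fun T => R ∪ X ⊆ S₀ ∪ T) := by
    intro X
    rw [hF, filter_filter]
    apply filter_congr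
    intro T _
    rw [hR, union_subset_iff, union_subset_iff]
    have : S₀ ⊆ S₀ ∪ T := subset_union_left
    tauto
  have hcount : ∀ X : Finset (Fin n), (F.filter (fun T => X ⊆ S₀ ∪ T)).card =
      (n - (R ∪ X).card).choose (n - t) := by
    intro X
    rw [hFR, hP]
    exact aux_count n k t (by omega) ht2 S₀ _ hS₀card (hR0.trans subset_union_left)
  have hFcard : F.card = (n - R.card).choose (n - t) := by
    have := hcount ∅
    simpa using this
  have hN : (Nat.choose (n - k) (t - k)) = (n - k).choose (n - t) := by
    rw [← Nat.choose_symm (by omega : t - k ≤ n - k)]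
    congr 1
    omega
  rw [hsumeq, hN]
  set N : ℝ := ((n - k).choose (n - t) : ℝ) with hNdef
  set A : ℝ := ((n - R.card).choose (n - t) : ℝ) with hA
  have hNpos : 0 < N := by
    rw [hNdef]; exact_mod_cast Nat.choose_pos (by omega)
  have hApos : 0 < A := by
    rw [hA]; exact_mod_cast Nat.choose_pos (by omega)
  have hWsum : ∑ T ∈ F, w T = ∑ S' : Finset (Fin n), μ S' *
      ((n - (R ∪ S').card).choose (n - t) : ℝ) := by
    have h1 : ∀ T, w T = ∑ S' : Finset (Fin n), if S' ⊆ S₀ ∪ T then μ S' else 0 := by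
      intro T
      rw [hw, ← sum_filter]
      apply sum_subset
      · intro S' h
        simp only [mem_powersetCard] at h
        simpa using h.1
      · intro S' h h'
        apply hμcard
        intro h2
        apply h'
        rw [mem_powersetCard]
        exact ⟨by simpa using h, h2⟩
    rw [sum_congr rfl fun T _ => h1 T, sum_comm]
    apply sum_congr rfl
    intro S' _
    rw [← hcount S', ← sum_filter, sum_const, nsmul_eq_mul, mul_comm]
  have hNW : N * ∑ T ∈ F, w T ≤ A ^ 2 * (1 / (1 - ε)) := by
    rw [hWsum, mul_sum]
    calc _ ≤ ∑ S' : Finset (Fin n), A ^ 2 * (μ S' * l ^ (S' ∩ R).card) := by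
          apply sum_le_sum
          intro S' _
          by_cases h : S'.card = k
          · have hd : (R ∪ S').card = R.card + (S' \ R).card := by
              rw [← card_union_of_disjoint disjoint_sdiff, union_sdiff_self_eq_union]
            have hi : (S' \ R).card + (S' ∩ R).card = k := by
              rw [card_sdiff_add_card_inter, h]
            have hle : R.card + (S' \ R).card ≤ n := by
              rw [← hd]; simpa using card_le_univ (R ∪ S')
            have := aux_main n t k R.card (S' \ R).card ht2 ht1 hRk hR2 (by omega) hle
            have e : k - (S' \ R).card = (S' ∩ R).card := by omega
            rw [e, ← hl] at this
            rw [hd]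
            have h2 := mul_le_mul_of_nonneg_left this (hμ0 S')
            calc _ = μ S' * (N * ((n - (R.card + (S' \ R).card)).choose (n - t) : ℝ)) := by ring
              _ ≤ _ := h2
              _ = _ := by ring
          · rw [hμcard S' h]; simp
      _ = A ^ 2 * ∑ S' : Finset (Fin n), (μ S' * l ^ (S' ∩ R).card) := by rw [mul_sum]
      _ ≤ _ := mul_le_mul_of_nonneg_left hg (by positivity)
  have hcs := sq_sum_div_le_sum_sq_div F (fun _ => (1 : ℝ)) (g := w) (fun T _ => hw0 T)
  simp only [sum_const, nsmul_eq_mul, mul_one, one_pow] at hcs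
  rw [hFcard] at hcs
  have hFne : F.Nonempty := by
    rw [← card_pos, hFcard]; exact Nat.choose_pos (by omega)
  have hWpos : 0 < ∑ T ∈ F, w T := sum_pos (fun T _ => hw0 T) hFne
  have hkey : (1 - ε) * N ≤ A ^ 2 / ∑ T ∈ F, w T := by
    rw [le_div_iff₀ hWpos]
    have he : 0 < 1 - ε := by linarith
    have := mul_le_mul_of_nonneg_left hNW he.le
    have e2 : (1 - ε) * (A ^ 2 * (1 / (1 - ε))) = A ^ 2 := by field_simp
    linarith
  have hlast := hkey.trans hcs
  rw [one_div_mul_eq_div, le_div_iff₀ hNpos]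
  have := mul_le_mul_of_nonneg_left hlast (hμ0 S)
  linarith
end

section
/- Let μ be a (1/α)-entropically independent probability distribution on k-subsets of [n] with α ∈ (0,1], and suppose that every marginal satisfies P_μ[i ∈ S] ≤ Ck/n for some constant C > 0. Let ε ∈ (0, 1/4], and let t be an integer with 2k < t ≤ n such that (2Ck²/n)·((n − 2k)/(t − 2k))^{1/α} ≤ log(1/(1 − ε)). Then for every S₀ with |S₀| = k and μ(S₀) > 0, the distribution of the output S₁ of one step of the Markov chain M^t_μ started at S₀ satisfies ‖P(S₀, ·) − μ‖_TV ≤ ε, where ‖ν − μ‖_TV := (1/2)·Σ_S |ν(S) − μ(S)|. -/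
open Finset

lemma aux_df (x y j : ℕ) (h : x ≤ y) :
    x.descFactorial j * y ^ j ≤ x ^ j * y.descFactorial j := by
  induction j with
  | zero => simp
  | succ j ih =>
    rw [Nat.descFactorial_succ, Nat.descFactorial_succ, pow_succ, pow_succ]
    have h1 : (x - j) * y ≤ x * (y - j) := by
      rw [Nat.sub_mul, Nat.mul_sub]
      have : x * j ≤ j * y := by rw [mul_comm]; exact Nat.mul_le_mul_left _ h
      omega
    calc (x - j) * x.descFactorial j * (y ^ j * y)
        = (x.descFactorial j * y ^ j) * ((x - j) * y) := by ring
      _ ≤ (x ^ j * y.descFactorial j) * (x * (y - j)) := Nat.mul_le_mul ih h1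
      _ = _ := by ring

lemma aux_df2 (s a m : ℕ) (h : s ≤ a) (hm : m ≤ s) :
    (s - m) ^ m * a.descFactorial m ≤ s.descFactorial m * (a - m) ^ m := by
  suffices H : ∀ i ≤ m, (s - m) ^ i * a.descFactorial i ≤ s.descFactorial i * (a - m) ^ i from
    H m le_rfl
  intro i
  induction i with
  | zero => simp
  | succ j ih =>
    intro hj
    have ih := ih (by omega)
    rw [Nat.descFactorial_succ, Nat.descFactorial_succ, pow_succ, pow_succ]
    have h1 : (s - m) * (a - j) ≤ (s - j) * (a - m) := by
      obtain ⟨p, rfl⟩ := Nat.exists_eq_add_of_le hm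
      obtain ⟨q, rfl⟩ := Nat.exists_eq_add_of_le h
      obtain ⟨r, rfl⟩ := Nat.exists_eq_add_of_le hj
      have e1 : j + 1 + r + p - (j + 1 + r) = p := by omega
      have e2 : j + 1 + r + p + q - j = 1 + r + p + q := by omega
      have e3 : j + 1 + r + p - j = 1 + r + p := by omega
      have e4 : j + 1 + r + p + q - (j + 1 + r) = p + q := by omega
      rw [e1, e2, e3, e4]
      nlinarith [Nat.zero_le (q + r * q)]
    calc (s - m) ^ j * (s - m) * ((a - j) * a.descFactorial j)
        = ((s - m) ^ j * a.descFactorial j) * ((s - m) * (a - j)) := by ring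
      _ ≤ (s.descFactorial j * (a - m) ^ j) * ((s - j) * (a - m)) := Nat.mul_le_mul ih h1
      _ = _ := by ring

lemma aux_count_s1 {ι : Type*} [DecidableEq ι] (X V : Finset ι) (hV : V ⊆ X) (s : ℕ) :
    X.card.choose s * s.descFactorial V.card =
      ((powersetCard s X).filter (fun T => V ⊆ T)).card * X.card.descFactorial V.card := by
  by_cases hs : V.card ≤ s
  · have h1 : ((powersetCard s X).filter (fun T => V ⊆ T)).card
        = (X.card - V.card).choose (s - V.card) := by
      rw [← card_sdiff_of_subset hV, ← card_powersetCard]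
      refine card_bij' (fun T _ => T \ V) (fun T _ => T ∪ V) ?_ ?_ ?_ ?_
      · intro T hT
        simp only [mem_filter, mem_powersetCard] at hT ⊢
        exact ⟨sdiff_subset_sdiff hT.1.1 le_rfl, by rw [card_sdiff_of_subset hT.2, hT.1.2]⟩
      · intro T hT
        simp only [mem_filter, mem_powersetCard] at hT ⊢
        refine ⟨⟨union_subset (hT.1.trans sdiff_subset) hV, ?_⟩, subset_union_right⟩
        rw [card_union_of_disjoint, hT.2]
        · omega
        · exact disjoint_of_subset_left hT.1 sdiff_disjoint
      · intro T hT
        simp only [mem_filter, mem_powersetCard] at hT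
        exact sdiff_union_of_subset hT.2
      · intro T hT
        simp only [mem_powersetCard] at hT
        exact union_sdiff_cancel_right (disjoint_of_subset_left hT.1 sdiff_disjoint)
    rw [h1, Nat.descFactorial_eq_factorial_mul_choose, Nat.descFactorial_eq_factorial_mul_choose]
    by_cases hx : s ≤ X.card
    · have := Nat.choose_mul (n := X.card) hs
      calc _ = V.card.factorial * (X.card.choose s * s.choose V.card) := by ring
        _ = _ := by rw [this]; ring
    · have hVX := card_le_card hV
      rw [Nat.choose_eq_zero_of_lt (by omega : X.card < s),
        Nat.choose_eq_zero_of_lt (by omega : X.card - V.card < s - V.card)]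
      simp
  · rw [Nat.descFactorial_of_lt (by omega)]
    have : (powersetCard s X).filter (fun T => V ⊆ T) = ∅ := by
      rw [filter_eq_empty_iff]
      intro T hT hVT
      rw [mem_powersetCard] at hT
      have := card_le_card hVT
      omega
    simp [this]

/-- numeric core -/
lemma aux_num (a s m j k N c c' : ℕ) (hsa : s ≤ a) (hks : k < s) (hmk : m ≤ k) (hjk : j ≤ k)
    (hmj : m + j ≤ a)
    (h1 : N * s.descFactorial m = c * a.descFactorial m)
    (h2 : N * s.descFactorial (m + j) = c' * a.descFactorial (m + j)) :
    (N : ℝ) * c' ≤ (c : ℝ) ^ 2 * (((a : ℝ) - k) / ((s : ℝ) - k)) ^ (k - j) := by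
  have hsm : 0 < s.descFactorial m := Nat.descFactorial_pos.2 (by omega)
  have ham : 0 < a.descFactorial m := Nat.descFactorial_pos.2 (by omega)
  have hamj : 0 < (a - m).descFactorial j := Nat.descFactorial_pos.2 (by omega)
  have e1 : ∀ x : ℕ, x.descFactorial (m + j) = x.descFactorial m * (x - m).descFactorial j := by
    intro x
    have := Nat.descFactorial_mul_descFactorial (n := x) (Nat.le_add_right m j)
    rw [Nat.add_sub_cancel_left] at this
    rw [← this, mul_comm]
  have h3 : c * (s - m).descFactorial j = c' * (a - m).descFactorial j := by
    rw [e1, e1, ← mul_assoc, h1] at h2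
    apply Nat.eq_of_mul_eq_mul_left ham
    linarith
  have h4 : c' * (a - m) ^ j ≤ c * (s - m) ^ j := by
    have := aux_df (s - m) (a - m) j (by omega)
    apply Nat.le_of_mul_le_mul_right _ hamj
    calc c' * (a - m) ^ j * (a - m).descFactorial j
        = (c * (s - m).descFactorial j) * (a - m) ^ j := by rw [h3]; ring
      _ = c * ((s - m).descFactorial j * (a - m) ^ j) := by ring
      _ ≤ c * ((s - m) ^ j * (a - m).descFactorial j) := Nat.mul_le_mul_left _ this
      _ = _ := by ring
  have h5 : N * (s - m) ^ m ≤ c * (a - m) ^ m := by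
    have := aux_df2 s a m hsa (by omega)
    apply Nat.le_of_mul_le_mul_right _ hsm
    calc N * (s - m) ^ m * s.descFactorial m
        = (N * s.descFactorial m) * (s - m) ^ m := by ring
      _ = c * ((s - m) ^ m * a.descFactorial m) := by rw [h1]; ring
      _ ≤ c * (s.descFactorial m * (a - m) ^ m) := Nat.mul_le_mul_left _ this
      _ = _ := by ring
  have h4' : (c' : ℝ) * ((a : ℝ) - m) ^ j ≤ c * ((s : ℝ) - m) ^ j := by
    have := (Nat.cast_le (α := ℝ)).2 h4
    push_cast [Nat.cast_sub (by omega : m ≤ a), Nat.cast_sub (by omega : m ≤ s)] at this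
    exact this
  have h5' : (N : ℝ) * ((s : ℝ) - m) ^ m ≤ c * ((a : ℝ) - m) ^ m := by
    have := (Nat.cast_le (α := ℝ)).2 h5
    push_cast [Nat.cast_sub (by omega : m ≤ a), Nat.cast_sub (by omega : m ≤ s)] at this
    exact this
  have rsk : (k : ℝ) < s := by exact_mod_cast hks
  have rmk : (m : ℝ) ≤ k := by exact_mod_cast hmk
  have rsa : (s : ℝ) ≤ a := by exact_mod_cast hsa
  have hx : 0 < (s : ℝ) - m := by linarith
  have hy : 0 < (a : ℝ) - m := by linarith
  set x := (s : ℝ) - m with hxdef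
  set y := (a : ℝ) - m with hydef
  have hq1 : 1 ≤ y / x := by rw [le_div_iff₀ hx]; linarith
  have hq0 : 0 < y / x := by positivity
  have hqB : y / x ≤ ((a : ℝ) - k) / ((s : ℝ) - k) := by
    rw [div_le_div_iff₀ hx (by linarith)]
    nlinarith
  have h6 : (c' : ℝ) * (y / x) ^ j ≤ c := by
    rw [div_pow, ← mul_div_assoc, div_le_iff₀ (by positivity)]
    exact h4'
  have h7 : (N : ℝ) ≤ c * (y / x) ^ m := by
    rw [div_pow, ← mul_div_assoc, le_div_iff₀ (by positivity)]
    exact h5'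
  have h8 : (N : ℝ) ≤ c * (y / x) ^ k :=
    h7.trans (mul_le_mul_of_nonneg_left (pow_le_pow_right₀ hq1 hmk) (by positivity))
  calc (N : ℝ) * c' ≤ c * (y / x) ^ k * c' := mul_le_mul_of_nonneg_right h8 (by positivity)
    _ = c * ((y / x) ^ (k - j) * (y / x) ^ j) * c' := by
        rw [← pow_add, Nat.sub_add_cancel hjk]
    _ = c * (y / x) ^ (k - j) * (c' * (y / x) ^ j) := by ring
    _ ≤ c * (y / x) ^ (k - j) * c := mul_le_mul_of_nonneg_left h6 (by positivity)
    _ = c ^ 2 * (y / x) ^ (k - j) := by ring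
    _ ≤ _ := by gcongr

lemma aux_EI
    (n k : ℕ) (hk : 0 < k) (hkn : k ≤ n)
    (μ : Finset (Fin n) → ℝ)
    (hμ0 : ∀ S, 0 ≤ μ S)
    (hμcard : ∀ S : Finset (Fin n), S.card ≠ k → μ S = 0)
    (hμ1 : ∑ S : Finset (Fin n), μ S = 1)
    (α : ℝ) (hα0 : 0 < α) (hα1 : α ≤ 1)
    (hEI : ∀ z : Fin n → ℝ, (∀ i, 0 ≤ z i) →
      (∑ S : Finset (Fin n), μ S * ∏ i ∈ S, z i ^ α) ^ ((1 : ℝ) / (k * α)) ≤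
        ∑ i : Fin n,
          ((∑ S ∈ Finset.univ.filter (fun S : Finset (Fin n) => i ∈ S), μ S) / k) * z i)
    (C : ℝ) (hC : 0 < C)
    (hmarg : ∀ i : Fin n,
      (∑ S ∈ Finset.univ.filter (fun S : Finset (Fin n) => i ∈ S), μ S) ≤ C * k / n)
    (B L : ℝ) (hB : 1 ≤ B) (hL : (2 * C * (k : ℝ) ^ 2 / n) * B ^ ((1 : ℝ) / α) ≤ L)
    (U : Finset (Fin n)) (hU : U.card ≤ 2 * k) :
    ∑ S : Finset (Fin n), μ S * B ^ (S ∩ U).card ≤ Real.exp L := by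
  have hB0 : 0 < B := by linarith
  have hkr : (0 : ℝ) < k := by exact_mod_cast hk
  have hnr : (0 : ℝ) < n := by exact_mod_cast (lt_of_lt_of_le hk hkn)
  set D := B ^ ((1 : ℝ) / α) with hD
  have hD0 : 0 < D := Real.rpow_pos_of_pos hB0 _
  have hDα : D ^ α = B := by
    rw [hD, ← Real.rpow_mul hB0.le, one_div_mul_cancel hα0.ne', Real.rpow_one]
  have h := hEI (fun i => if i ∈ U then D else 1) (by intro i; split_ifs <;> linarith)
  have hprod : ∀ S : Finset (Fin n),
      ∏ i ∈ S, (if i ∈ U then D else (1 : ℝ)) ^ α = B ^ (S ∩ U).card := by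
    intro S
    have : ∀ i ∈ S, (if i ∈ U then D else (1 : ℝ)) ^ α = if i ∈ U then B else 1 := by
      intro i _
      split_ifs
      · exact hDα
      · exact Real.one_rpow _
    rw [prod_congr rfl this, prod_ite_mem, prod_const]
  simp only [hprod] at h
  set G := ∑ S : Finset (Fin n), μ S * B ^ (S ∩ U).card with hG
  have hG0 : 0 ≤ G := sum_nonneg fun S _ => mul_nonneg (hμ0 S) (by positivity)
  set M : Fin n → ℝ := fun i => ∑ S ∈ Finset.univ.filter (fun S : Finset (Fin n) => i ∈ S), μ S
    with hM
  have hMs : ∑ i, M i = k := by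
    have : ∑ i, M i = ∑ S : Finset (Fin n), (S.card : ℝ) * μ S := by
      simp only [hM, sum_filter]
      rw [sum_comm]
      refine sum_congr rfl fun S _ => ?_
      simp
    rw [this]
    have h2 : ∀ S ∈ (univ : Finset (Finset (Fin n))), (S.card : ℝ) * μ S = k * μ S := by
      intro S _
      by_cases hS : S.card = k
      · rw [hS]
      · rw [hμcard S hS]; simp
    rw [sum_congr rfl h2, ← mul_sum, hμ1, mul_one]
  have hrhs : ∑ i, (M i / k) * (if i ∈ U then D else 1) ≤ 1 + 2 * k * (C / n) * D := by
    calc ∑ i, (M i / k) * (if i ∈ U then D else 1)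
        ≤ ∑ i, (M i / k + if i ∈ U then (C / n) * D else 0) := by
          refine sum_le_sum fun i _ => ?_
          have hMi : 0 ≤ M i := sum_nonneg fun S _ => hμ0 S
          have hMi' : 0 ≤ M i / k := by positivity
          have h2 : M i / k ≤ C / n := by
            rw [div_le_iff₀ hkr]
            calc M i ≤ C * k / n := hmarg i
              _ = _ := by ring
          split_ifs
          · have := mul_le_mul_of_nonneg_right h2 hD0.le
            linarith
          · linarith
      _ = 1 + U.card * ((C / n) * D) := by
          rw [sum_add_distrib, ← sum_div, hMs, div_self hkr.ne', sum_ite_mem]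
          simp
      _ ≤ 1 + 2 * k * (C / n) * D := by
          have : (U.card : ℝ) ≤ 2 * k := by exact_mod_cast hU
          have h3 : 0 ≤ (C / n) * D := by positivity
          nlinarith
  have hfin : G ^ ((1 : ℝ) / (k * α)) ≤ Real.exp (2 * k * (C / n) * D) :=
    (h.trans hrhs).trans (by linarith [Real.add_one_le_exp (2 * k * (C / n) * D)])
  have hkα : 0 < (k : ℝ) * α := by positivity
  have h9 := Real.rpow_le_rpow (Real.rpow_nonneg hG0 _) hfin hkα.le
  rw [← Real.rpow_mul hG0, one_div_mul_cancel hkα.ne', Real.rpow_one, ← Real.exp_mul] at h9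
  refine h9.trans (Real.exp_le_exp.2 (le_trans ?_ hL))
  have h10 : 0 ≤ (2 * C * (k : ℝ) ^ 2 / n) * D := by positivity
  calc 2 * k * (C / n) * D * (k * α) = ((2 * C * (k : ℝ) ^ 2 / n) * D) * α := by ring
    _ ≤ ((2 * C * (k : ℝ) ^ 2 / n) * D) * 1 := mul_le_mul_of_nonneg_left hα1 h10
    _ = _ := mul_one _

/-- One step of the Markov chain `M^t_μ` from any `S₀` in the support of a
`(1/α)`-entropically independent, nearly isotropic distribution `μ` lands within total
variation distance `ε` of `μ`, for `t` satisfying the stated condition. -/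
theorem one_step_tv_distance
    (n k t : ℕ) (hk : 0 < k) (hkn : k ≤ n)
    (μ : Finset (Fin n) → ℝ)
    (hμ0 : ∀ S, 0 ≤ μ S)
    (hμcard : ∀ S : Finset (Fin n), S.card ≠ k → μ S = 0)
    (hμ1 : ∑ S : Finset (Fin n), μ S = 1)
    (α : ℝ) (hα0 : 0 < α) (hα1 : α ≤ 1)
    -- (1/α)-entropic independence of μ
    (hEI : ∀ z : Fin n → ℝ, (∀ i, 0 ≤ z i) →
      (∑ S : Finset (Fin n), μ S * ∏ i ∈ S, z i ^ α) ^ ((1 : ℝ) / (k * α)) ≤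
        ∑ i : Fin n,
          ((∑ S ∈ Finset.univ.filter (fun S : Finset (Fin n) => i ∈ S), μ S) / k) * z i)
    (C : ℝ) (hC : 0 < C)
    -- all marginals are at most Ck/n
    (hmarg : ∀ i : Fin n,
      (∑ S ∈ Finset.univ.filter (fun S : Finset (Fin n) => i ∈ S), μ S) ≤ C * k / n)
    (ε : ℝ) (hε0 : 0 < ε) (hε1 : ε ≤ 1 / 4)
    (ht1 : 2 * k < t) (ht2 : t ≤ n)
    (hcond : (2 * C * (k : ℝ) ^ 2 / n) *
        (((n : ℝ) - 2 * k) / ((t : ℝ) - 2 * k)) ^ ((1 : ℝ) / α) ≤ Real.log (1 / (1 - ε)))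
    (S₀ : Finset (Fin n)) (hS₀card : S₀.card = k) (hS₀pos : 0 < μ S₀) :
    (1 / 2 : ℝ) *
        ∑ S ∈ Finset.powersetCard k (Finset.univ : Finset (Fin n)),
          |(1 / (Nat.choose (n - k) (t - k) : ℝ)) *
              (∑ T ∈ Finset.powersetCard (t - k) (Finset.univ \ S₀),
                (if S ⊆ S₀ ∪ T then
                  μ S / (∑ S' ∈ Finset.powersetCard k (S₀ ∪ T), μ S') else 0)) - μ S| ≤ ε := by
  classical
  have rt1 : (2 : ℝ) * k < t := by exact_mod_cast ht1
  have rt2 : (t : ℝ) ≤ n := by exact_mod_cast ht2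
  set B : ℝ := ((n : ℝ) - 2 * k) / ((t : ℝ) - 2 * k) with hBdef
  have hB : 1 ≤ B := by
    rw [hBdef, le_div_iff₀ (by linarith)]; linarith
  have he : 0 < 1 - ε := by linarith
  set X : Finset (Fin n) := univ \ S₀ with hX
  have hXc : X.card = n - k := by
    rw [hX, card_sdiff_of_subset (subset_univ _), hS₀card]; simp
  set F := powersetCard (t - k) X with hF
  have hFc : F.card = (n - k).choose (t - k) := by rw [hF, card_powersetCard, hXc]
  set N := (n - k).choose (t - k) with hN
  have hNpos : (0 : ℝ) < N := by
    exact_mod_cast Nat.choose_pos (by omega : t - k ≤ n - k)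
  set w : Finset (Fin n) → ℝ := fun T => ∑ S' ∈ powersetCard k (S₀ ∪ T), μ S' with hw
  have hwpos : ∀ T, 0 < w T := by
    intro T
    refine lt_of_lt_of_le hS₀pos ?_
    exact single_le_sum (f := μ) (fun S _ => hμ0 S)
      (mem_powersetCard.2 ⟨subset_union_left, hS₀card⟩)
  set P : Finset (Fin n) → ℝ := fun S => (1 / (N : ℝ)) *
    (∑ T ∈ F, (if S ⊆ S₀ ∪ T then μ S / w T else 0)) with hP
  change (1 / 2 : ℝ) * ∑ S ∈ powersetCard k (univ : Finset (Fin n)), |P S - μ S| ≤ ε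
  have hsub : ∀ V T : Finset (Fin n), V ⊆ S₀ ∪ T ↔ V \ S₀ ⊆ T := by
    intro V T
    exact sdiff_le_iff.symm
  have hμk : ∑ S ∈ powersetCard k (univ : Finset (Fin n)), μ S = 1 := by
    rw [← hμ1]
    refine sum_subset (subset_univ _) fun S _ hS => hμcard S fun h => hS ?_
    exact mem_powersetCard.2 ⟨subset_univ _, h⟩
  have hPsum : ∑ S ∈ powersetCard k (univ : Finset (Fin n)), P S = 1 := by
    simp only [hP]
    rw [← mul_sum, sum_comm]
    have : ∀ T ∈ F, ∑ S ∈ powersetCard k (univ : Finset (Fin n)),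
        (if S ⊆ S₀ ∪ T then μ S / w T else 0) = 1 := by
      intro T _
      rw [← sum_filter]
      have : (powersetCard k (univ : Finset (Fin n))).filter (fun S => S ⊆ S₀ ∪ T)
          = powersetCard k (S₀ ∪ T) := by
        ext S
        simp only [mem_filter, mem_powersetCard, subset_univ, true_and]
        exact and_comm
      rw [this, ← sum_div]
      exact div_self (hwpos T).ne'
    rw [sum_congr rfl this, sum_const, hFc, nsmul_eq_mul, mul_one, one_div_mul_cancel hNpos.ne']
  have key : ∀ S ∈ powersetCard k (univ : Finset (Fin n)), (1 - ε) * μ S ≤ P S := by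
    intro S hS
    have hSc : S.card = k := (mem_powersetCard.1 hS).2
    set U := S₀ ∪ S with hU
    set A := F.filter (fun T => S ⊆ S₀ ∪ T) with hA
    have hUc : U.card ≤ 2 * k := by
      have := card_union_le S₀ S
      rw [← hU] at this
      omega
    have hEx := aux_EI n k hk hkn μ hμ0 hμcard hμ1 α hα0 hα1 hEI C hC hmarg B _ hB hcond U hUc
    rw [Real.exp_log (by positivity)] at hEx
    have hVX : ∀ V : Finset (Fin n), V \ S₀ ⊆ X := fun V =>
      sdiff_subset_sdiff (subset_univ _) le_rfl
    set m := (S \ S₀).card with hm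
    have hmk : m ≤ k := hSc ▸ card_le_card sdiff_subset
    have hc1 : N * (t - k).descFactorial m = A.card * (n - k).descFactorial m := by
      have := aux_count_s1 X (S \ S₀) (hVX S) (t - k)
      rw [hXc] at this
      rw [hN, this, hA]
      simp only [hsub]
      rfl
    have hpair : ∀ S' : Finset (Fin n), S'.card = k →
        (N : ℝ) * (A.filter (fun T => S' ⊆ S₀ ∪ T)).card
          ≤ (A.card : ℝ) ^ 2 * B ^ (S' ∩ U).card := by
      intro S' hS'
      set j := (S' \ U).card with hj
      have hjk : j ≤ k := hS' ▸ card_le_card sdiff_subset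
      have hkj : (S' ∩ U).card = k - j := by
        have := card_sdiff_add_card_inter S' U
        omega
      have hun : (S ∪ S') \ S₀ = (S \ S₀) ∪ (S' \ U) := by
        ext i
        simp only [hU, mem_sdiff, mem_union]
        tauto
      have hunc : ((S ∪ S') \ S₀).card = m + j := by
        rw [hun, card_union_of_disjoint]
        rw [disjoint_left]
        intro i
        simp only [hU, mem_sdiff, mem_union]
        tauto
      have hc2 : N * (t - k).descFactorial (m + j) =
          (A.filter (fun T => S' ⊆ S₀ ∪ T)).card * (n - k).descFactorial (m + j) := by
        have := aux_count_s1 X ((S ∪ S') \ S₀) (hVX _) (t - k)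
        rw [hXc, hunc] at this
        rw [hN, this, hA, filter_filter]
        simp only [← hsub, union_subset_iff]
        rfl
      have hmj : m + j ≤ n - k := by
        rw [← hunc, ← hXc]; exact card_le_card (hVX _)
      have := aux_num (n - k) (t - k) m j k N A.card _ (by omega) (by omega) hmk hjk hmj hc1 hc2
      rw [hkj]
      convert this using 3
      rw [hBdef, Nat.cast_sub (by omega), Nat.cast_sub (by omega)]
      congr 1 <;> ring
    have hW : (N : ℝ) * ∑ T ∈ A, w T ≤ (A.card : ℝ) ^ 2 * (1 / (1 - ε)) := by
      have hW1 : ∑ T ∈ A, w T = ∑ S' ∈ powersetCard k (univ : Finset (Fin n)),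
          μ S' * (A.filter (fun T => S' ⊆ S₀ ∪ T)).card := by
        have : ∀ T ∈ A, w T = ∑ S' ∈ powersetCard k (univ : Finset (Fin n)),
            if S' ⊆ S₀ ∪ T then μ S' else 0 := by
          intro T _
          rw [← sum_filter]
          refine sum_congr ?_ fun _ _ => rfl
          ext V
          simp only [mem_filter, mem_powersetCard, subset_univ, true_and]
          exact and_comm
        rw [sum_congr rfl this, sum_comm]
        refine sum_congr rfl fun S' _ => ?_
        rw [← sum_filter, sum_const, nsmul_eq_mul, mul_comm]
      rw [hW1, mul_sum]
      calc ∑ S' ∈ powersetCard k (univ : Finset (Fin n)),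
            (N : ℝ) * (μ S' * (A.filter (fun T => S' ⊆ S₀ ∪ T)).card)
          ≤ ∑ S' ∈ powersetCard k (univ : Finset (Fin n)),
            (A.card : ℝ) ^ 2 * (μ S' * B ^ (S' ∩ U).card) := by
            refine sum_le_sum fun S' hS' => ?_
            have := mul_le_mul_of_nonneg_left (hpair S' (mem_powersetCard.1 hS').2) (hμ0 S')
            linarith
        _ = (A.card : ℝ) ^ 2 * ∑ S' ∈ powersetCard k (univ : Finset (Fin n)),
            (μ S' * B ^ (S' ∩ U).card) := by rw [mul_sum]
        _ ≤ (A.card : ℝ) ^ 2 * ∑ S' : Finset (Fin n), (μ S' * B ^ (S' ∩ U).card) := by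
            refine mul_le_mul_of_nonneg_left ?_ (by positivity)
            exact sum_le_sum_of_subset_of_nonneg (subset_univ _)
              fun i _ _ => mul_nonneg (hμ0 i) (by positivity)
        _ ≤ _ := mul_le_mul_of_nonneg_left hEx (by positivity)
    have hApos : 0 < A.card := by
      rcases Nat.eq_zero_or_pos A.card with h0 | h0
      · rw [h0, zero_mul] at hc1
        have h1 : 0 < N := by exact_mod_cast hNpos
        have h2 : 0 < (t - k).descFactorial m := Nat.descFactorial_pos.2 (by omega)
        have := Nat.mul_pos h1 h2
        omega
      · exact h0
    have hWpos : 0 < ∑ T ∈ A, w T := sum_pos (fun T _ => hwpos T) (card_pos.1 hApos)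
    have hCS : (A.card : ℝ) ^ 2 / ∑ T ∈ A, w T ≤ ∑ T ∈ A, 1 / w T := by
      have := sq_sum_div_le_sum_sq_div A (fun _ => (1 : ℝ)) (g := w) (fun T _ => hwpos T)
      simpa using this
    have hlow : (1 - ε) * N ≤ ∑ T ∈ A, 1 / w T := by
      refine le_trans ?_ hCS
      rw [le_div_iff₀ hWpos]
      have := mul_le_mul_of_nonneg_left hW he.le
      calc (1 - ε) * N * ∑ T ∈ A, w T = (1 - ε) * (N * ∑ T ∈ A, w T) := by ring
        _ ≤ (1 - ε) * ((A.card : ℝ) ^ 2 * (1 / (1 - ε))) := this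
        _ = _ := by field_simp
    have hPS : P S = (1 / (N : ℝ)) * (μ S * ∑ T ∈ A, 1 / w T) := by
      simp only [hP]
      rw [← sum_filter]
      congr 1
      rw [mul_sum]
      refine sum_congr rfl fun T _ => ?_
      rw [mul_one_div]
    rw [hPS, one_div, inv_mul_eq_div, le_div_iff₀ hNpos]
    have := mul_le_mul_of_nonneg_left hlow (hμ0 S)
    linarith
  have habs : ∑ S ∈ powersetCard k (univ : Finset (Fin n)), |P S - μ S| ≤
      ∑ S ∈ powersetCard k (univ : Finset (Fin n)), (P S - μ S + 2 * ε * μ S) := by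
    refine sum_le_sum fun S hS => ?_
    have h1 := key S hS
    have h2 : 0 ≤ ε * μ S := mul_nonneg hε0.le (hμ0 S)
    rw [abs_le]
    constructor <;> linarith
  rw [sum_add_distrib, sum_sub_distrib, hPsum, ← mul_sum, hμk] at habs
  linarith
end

section
/- Let μ be a probability distribution on k-subsets of [n], let R ⊆ [n] with |R| = r, and let t be an integer with r ≤ t ≤ n and r < n. If T' is drawn uniformly at random from the (t−r)-element subsets of [n] \ R, then E_{T'}[ Σ_{S' ⊆ R ∪ T'} μ(S') ] ≤ Σ_{S' : |S'| = k} μ(S') · ((t − r)/(n − r))^{|S' \ R|}. -/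
open Finset

lemma choose_ratio_aux (N m : ℕ) (hm : m ≤ N) (j : ℕ) (hj : j ≤ m) :
    (N - j).choose (m - j) * N ^ j ≤ N.choose m * m ^ j := by
  induction j with
  | zero => simp
  | succ j ih =>
    have ih := ih (by omega)
    obtain ⟨b, rfl⟩ : ∃ b, m = j + 1 + b := ⟨m - (j + 1), by omega⟩
    obtain ⟨c, rfl⟩ : ∃ c, N = j + 1 + b + c := ⟨N - (j + 1 + b), by omega⟩
    have e1 : j + 1 + b + c - (j + 1) = b + c := by omega
    have e2 : j + 1 + b - (j + 1) = b := by omega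
    have e3 : j + 1 + b + c - j = b + c + 1 := by omega
    have e4 : j + 1 + b - j = b + 1 := by omega
    rw [e1, e2]
    rw [e3, e4] at ih
    have key := Nat.add_one_mul_choose_eq (b + c) b
    have h2 : (b + 1) * (j + 1 + b + c) ≤ (j + 1 + b) * (b + c + 1) := by nlinarith
    refine Nat.le_of_mul_le_mul_left (c := b + c + 1) ?_ (by omega)
    generalize (j + 1 + b + c).choose (j + 1 + b) = X at *
    generalize (b + c + 1).choose (b + 1) = Y at *
    generalize (b + c).choose b = Z at *
    calc (b + c + 1) * (Z * (j + 1 + b + c) ^ (j + 1))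
        = ((b + c + 1) * Z) * (j + 1 + b + c) ^ (j + 1) := by ring
      _ = (Y * (j + 1 + b + c) ^ j) * ((b + 1) * (j + 1 + b + c)) := by rw [key]; ring
      _ ≤ (X * (j + 1 + b) ^ j) * ((j + 1 + b) * (b + c + 1)) := Nat.mul_le_mul ih h2
      _ = (b + c + 1) * (X * (j + 1 + b) ^ (j + 1)) := by ring

lemma count_aux {α : Type*} [DecidableEq α] (U A : Finset α) (hA : A ⊆ U) (m : ℕ)
    (hm : m ≤ U.card) :
    ((powersetCard m U).filter (fun T => A ⊆ T)).card * U.card ^ A.card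
      ≤ U.card.choose m * m ^ A.card := by
  by_cases hj : A.card ≤ m
  · refine le_trans (Nat.mul_le_mul_right _ ?_) (choose_ratio_aux _ m hm _ hj)
    rw [← card_sdiff_of_subset hA, ← card_powersetCard]
    refine card_le_card_of_injOn (fun T => T \ A) ?_ ?_
    · intro T hT
      simp only [coe_filter, mem_powersetCard, Set.mem_ofPred_eq] at hT
      simp only [mem_coe, mem_powersetCard]
      exact ⟨sdiff_subset_sdiff hT.1.1 le_rfl, by rw [card_sdiff_of_subset hT.2, hT.1.2]⟩
    · intro T hT T2 hT2 h
      simp only [coe_filter, mem_powersetCard, Set.mem_ofPred_eq] at hT hT2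
      have h : T \ A = T2 \ A := h
      rw [← sdiff_union_of_subset hT.2, h, sdiff_union_of_subset hT2.2]
  · have : (powersetCard m U).filter (fun T => A ⊆ T) = ∅ := by
      rw [filter_eq_empty_iff]
      intro T hT h
      rw [mem_powersetCard] at hT
      exact hj (hT.2 ▸ card_le_card h)
    rw [this]; simp

/-- For a uniformly random `(t-r)`-subset `T'` of `[n] \ R` (with `|R| = r`),
`E[ Σ_{S' ⊆ R ∪ T'} μ(S') ] ≤ Σ_{|S'| = k} μ(S') · ((t-r)/(n-r))^{|S' \ R|}`. -/
theorem expected_restricted_mass_bound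
    (n k r t : ℕ) (hk : 0 < k) (hkn : k ≤ n)
    (μ : Finset (Fin n) → ℝ)
    (hμ0 : ∀ S, 0 ≤ μ S)
    (hμcard : ∀ S : Finset (Fin n), S.card ≠ k → μ S = 0)
    (hμ1 : ∑ S : Finset (Fin n), μ S = 1)
    (R : Finset (Fin n)) (hR : R.card = r)
    (hrt : r ≤ t) (htn : t ≤ n) (hrn : r < n) :
    (1 / (Nat.choose (n - r) (t - r) : ℝ)) *
        ∑ T' ∈ Finset.powersetCard (t - r) (Finset.univ \ R),
          (∑ S' ∈ Finset.powersetCard k (R ∪ T'), μ S') ≤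
      ∑ S' ∈ Finset.powersetCard k (Finset.univ : Finset (Fin n)),
        μ S' * ((((t : ℝ) - r) / ((n : ℝ) - r)) ^ ((S' \ R).card)) := by
  have hU : (Finset.univ \ R : Finset (Fin n)).card = n - r := by
    rw [card_sdiff_of_subset (subset_univ _), hR, card_univ, Fintype.card_fin]
  have hswap : ∑ T' ∈ powersetCard (t - r) (Finset.univ \ R),
      (∑ S' ∈ powersetCard k (R ∪ T'), μ S') =
      ∑ S' ∈ powersetCard k (Finset.univ : Finset (Fin n)),
        ((((powersetCard (t - r) (Finset.univ \ R)).filter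
          (fun T => S' \ R ⊆ T)).card : ℕ) : ℝ) * μ S' := by
    have h1 : ∀ T' : Finset (Fin n), powersetCard k (R ∪ T') =
        (powersetCard k (Finset.univ : Finset (Fin n))).filter (fun S => S \ R ⊆ T') := by
      intro T'
      ext S
      simp only [mem_powersetCard, mem_filter, subset_univ, true_and]
      rw [← Finset.le_iff_subset, ← Finset.le_iff_subset, sdiff_le_iff, and_comm]; rfl
    simp_rw [h1, sum_filter]
    rw [sum_comm]
    refine sum_congr rfl fun S _ => ?_
    rw [← sum_filter, sum_const, nsmul_eq_mul]
  rw [hswap, mul_sum]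
  refine sum_le_sum fun S _ => ?_
  have hc := count_aux (Finset.univ \ R) (S \ R) (sdiff_subset_sdiff (subset_univ _) le_rfl)
    (t - r) (by omega)
  rw [hU] at hc
  have hN : (0 : ℝ) < (n : ℝ) - r := by
    have : (r : ℝ) < n := by exact_mod_cast hrn
    linarith
  have hC : (0 : ℝ) < ((n - r).choose (t - r) : ℝ) := by
    exact_mod_cast Nat.choose_pos (by omega)
  have hc' := (Nat.cast_le (α := ℝ)).2 hc
  push_cast [Nat.cast_sub hrt, Nat.cast_sub hrn.le] at hc'
  rw [mul_comm (_ : ℝ) (μ S), mul_left_comm]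
  refine mul_le_mul_of_nonneg_left ?_ (hμ0 S)
  rw [div_pow, one_div, inv_mul_eq_div, div_le_div_iff₀ hC (pow_pos hN _)]
  linarith
end

section
/- Let μ be a probability distribution on k-subsets of [n], let c ∈ (0,1], and let p₁,…,p_n > 0 satisfy Σ_{i=1}^n p_i = k and p_i ≥ c·P_μ[i ∈ S] for all i. Set t_i := ⌈(n/k)·p_i⌉ and let μ' be the subdivision of μ with t_i copies of each element i, over ground set U. Then (1) |U| = Σ_{i=1}^n t_i ≤ 2n, and (2) for every i ∈ [n] and j ∈ [t_i], the marginal of the copy i^{(j)} under μ' is at most k/(cn). -/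
open Finset

/-- The subdivision of a distribution `μ` on subsets of `[n]`, where element `i` is split into
`t i` copies. -/
noncomputable def subdivision {n : ℕ} (t : Fin n → ℕ) (μ : Finset (Fin n) → ℝ) :
    Finset ((i : Fin n) × Fin (t i)) → ℝ := fun S' =>
  if (S'.image Sigma.fst).card = S'.card then
    μ (S'.image Sigma.fst) / ∏ i ∈ S'.image Sigma.fst, (t i : ℝ)
  else 0

lemma card_transversals {n : ℕ} (t : Fin n → ℕ) (i : Fin n) (j : Fin (t i))
    (T : Finset (Fin n)) :
    ((Finset.univ.filter (fun S' : Finset ((i : Fin n) × Fin (t i)) =>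
      (⟨i, j⟩ : (i : Fin n) × Fin (t i)) ∈ S' ∧ S'.image Sigma.fst = T ∧
        (S'.image Sigma.fst).card = S'.card)).card) ≤ ∏ a ∈ T.erase i, t a := by
  classical
  have hc : ((T.erase i).pi (fun a => (Finset.univ : Finset (Fin (t a))))).card
      = ∏ a ∈ T.erase i, t a := by
    simp [Finset.card_pi]
  rw [← hc]
  let g : ((a : Fin n) → a ∈ T.erase i → Fin (t a)) → Finset ((i : Fin n) × Fin (t i)) :=
    fun f => insert ⟨i, j⟩ ((T.erase i).attach.image
      (fun a => (⟨a.1, f a.1 a.2⟩ : (i : Fin n) × Fin (t i))))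
  refine le_trans (Finset.card_le_card (t := Finset.image g _) ?_) Finset.card_image_le
  intro S hS
  simp only [Finset.mem_filter, Finset.mem_univ, true_and] at hS
  obtain ⟨hx, hT, hcard⟩ := hS
  have hinj : Set.InjOn Sigma.fst (S : Set ((i : Fin n) × Fin (t i))) :=
    Finset.card_image_iff.mp hcard
  have hex : ∀ a, a ∈ T.erase i → ∃ b : Fin (t a),
      (⟨a, b⟩ : (i : Fin n) × Fin (t i)) ∈ S := by
    intro a ha
    have ha' := Finset.mem_of_mem_erase ha
    rw [← hT, Finset.mem_image] at ha'
    obtain ⟨⟨a', b⟩, hy, rfl⟩ := ha'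
    exact ⟨b, hy⟩
  choose f hf using hex
  refine Finset.mem_image.mpr ⟨f, by simp, ?_⟩
  ext y
  simp only [g, Finset.mem_insert, Finset.mem_image, Finset.mem_attach, true_and]
  constructor
  · rintro (rfl | ⟨a, rfl⟩)
    · exact hx
    · exact hf _ _
  · intro hy
    by_cases h : y.1 = i
    · left
      exact hinj hy hx h
    · right
      have hm : y.1 ∈ T.erase i := by
        rw [Finset.mem_erase, ← hT]
        exact ⟨h, Finset.mem_image_of_mem _ hy⟩
      exact ⟨⟨y.1, hm⟩, hinj (hf _ _) hy rfl⟩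

/-- Given marginal overestimates `p_i ≥ c·P_μ[i ∈ S]` with `Σ p_i = k`, the
isotropic transformation `μ'` of `μ` with `t_i = ⌈(n/k)p_i⌉` copies of element `i` has
(1) ground set of size at most `2n`, and (2) all marginals at most `k/(cn)`. -/
theorem isotropic_transformation
    (n k : ℕ) (hk : 0 < k) (hkn : k ≤ n)
    (μ : Finset (Fin n) → ℝ)
    (hμ0 : ∀ S, 0 ≤ μ S)
    (hμcard : ∀ S : Finset (Fin n), S.card ≠ k → μ S = 0)
    (hμ1 : ∑ S : Finset (Fin n), μ S = 1)
    (c : ℝ) (hc0 : 0 < c) (hc1 : c ≤ 1)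
    (p : Fin n → ℝ) (hp : ∀ i, 0 < p i)
    (hpsum : ∑ i : Fin n, p i = k)
    (hpmarg : ∀ i : Fin n,
      c * (∑ S ∈ Finset.univ.filter (fun S : Finset (Fin n) => i ∈ S), μ S) ≤ p i)
    (t : Fin n → ℕ) (htdef : ∀ i, t i = ⌈(n : ℝ) / k * p i⌉₊) :
    ((∑ i : Fin n, t i) ≤ 2 * n) ∧
      (∀ (i : Fin n) (j : Fin (t i)),
        (∑ S' ∈ Finset.univ.filter
            (fun S' : Finset ((i : Fin n) × Fin (t i)) =>
              (⟨i, j⟩ : (i : Fin n) × Fin (t i)) ∈ S'),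
          subdivision t μ S') ≤ k / (c * n)) := by
  classical
  have hk' : (0 : ℝ) < k := by exact_mod_cast hk
  have hn' : (0 : ℝ) < n := by exact_mod_cast lt_of_lt_of_le hk hkn
  have htlow : ∀ i, (n : ℝ) / k * p i ≤ t i := fun i => by
    rw [htdef i]; exact Nat.le_ceil _
  have htpos : ∀ i, (0 : ℝ) < t i := fun i =>
    lt_of_lt_of_le (mul_pos (div_pos hn' hk') (hp i)) (htlow i)
  constructor
  · have h1 : ∀ i ∈ (Finset.univ : Finset (Fin n)), (t i : ℝ) ≤ (n : ℝ) / k * p i + 1 :=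
      fun i _ => by
        rw [htdef i]
        exact (Nat.ceil_lt_add_one (mul_pos (div_pos hn' hk') (hp i)).le).le
    have h2 := Finset.sum_le_sum h1
    rw [Finset.sum_add_distrib, ← Finset.mul_sum, hpsum, div_mul_cancel₀ _ hk'.ne'] at h2
    simp only [Finset.sum_const, Finset.card_univ, Fintype.card_fin, nsmul_eq_mul, mul_one] at h2
    have h3 : ((∑ i : Fin n, t i : ℕ) : ℝ) ≤ ((2 * n : ℕ) : ℝ) := by
      push_cast
      linarith
    exact_mod_cast h3
  · intro i j
    have key : (∑ S' ∈ Finset.univ.filter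
            (fun S' : Finset ((i : Fin n) × Fin (t i)) =>
              (⟨i, j⟩ : (i : Fin n) × Fin (t i)) ∈ S'),
          subdivision t μ S') ≤
        ∑ T ∈ Finset.univ.filter (fun S : Finset (Fin n) => i ∈ S), μ T / t i := by
      rw [← Finset.sum_fiberwise_of_maps_to
        (t := Finset.univ.filter (fun S : Finset (Fin n) => i ∈ S))
        (g := fun S' => S'.image Sigma.fst)]
      · refine Finset.sum_le_sum fun T hT => ?_
        have hiT : i ∈ T := (Finset.mem_filter.mp hT).2
        have e : ∀ S' ∈ (Finset.univ.filter
            (fun S' : Finset ((i : Fin n) × Fin (t i)) =>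
              (⟨i, j⟩ : (i : Fin n) × Fin (t i)) ∈ S')).filter
              (fun S' => S'.image Sigma.fst = T),
            subdivision t μ S' = if (S'.image Sigma.fst).card = S'.card then
              μ T / ∏ i ∈ T, (t i : ℝ) else 0 := by
          intro S' hS'
          have := (Finset.mem_filter.mp hS').2
          simp only [subdivision, this]
        rw [Finset.sum_congr rfl e, ← Finset.sum_filter, Finset.sum_const, nsmul_eq_mul,
          Finset.filter_filter, Finset.filter_filter]
        have hcard := card_transversals t i j T
        have hcard' : ((Finset.univ.filter (fun S' : Finset ((i : Fin n) × Fin (t i)) =>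
            (⟨i, j⟩ : (i : Fin n) × Fin (t i)) ∈ S' ∧ S'.image Sigma.fst = T ∧
            (S'.image Sigma.fst).card = S'.card)).card : ℝ) ≤ ∏ a ∈ T.erase i, (t a : ℝ) := by
          exact_mod_cast hcard
        have hP : 0 < ∏ a ∈ T.erase i, (t a : ℝ) := Finset.prod_pos fun a _ => htpos a
        have hprod := Finset.mul_prod_erase T (fun a => (t a : ℝ)) hiT
        rw [← hprod]
        refine (mul_le_mul_of_nonneg_right hcard'
          (div_nonneg (hμ0 T) (mul_pos (htpos i) hP).le)).trans (le_of_eq ?_)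
        have := (htpos i).ne'
        have := hP.ne'
        field_simp
      · intro S' hS'
        simp only [Finset.mem_filter, Finset.mem_univ, true_and] at hS' ⊢
        exact Finset.mem_image.mpr ⟨_, hS', rfl⟩
    refine key.trans ?_
    rw [← Finset.sum_div, div_le_div_iff₀ (htpos i) (mul_pos hc0 hn')]
    have h1 := hpmarg i
    have h2 := htlow i
    rw [div_mul_eq_mul_div, div_le_iff₀ hk'] at h2
    have h3 := mul_le_mul_of_nonneg_left h1 hn'.le
    linarith
end

section
/- Let μ be a (1/α)-entropically independent probability distribution on k-subsets of [n] with α ∈ (0,1], let t₁,…,t_n be positive integers, and let μ' be the subdivision of μ with t_i copies of each element i. Then μ' is (1/α)-entropically independent: for all nonnegative reals (z_i^{(j)})_{i ∈ [n], j ∈ [t_i]}, g_{μ'}((z_i^{(j)})^α)^{1/(kα)} ≤ Σ_{i,j} q_i^{(j)} z_i^{(j)}, where q_i^{(j)} is 1/k times the marginal of copy i^{(j)} under μ'. -/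
open Finset

lemma subdivision_fiber {n : ℕ} (t : Fin n → ℕ) (w : ((i : Fin n) × Fin (t i)) → ℝ)
    (S : Finset (Fin n)) :
    ∑ S' ∈ Finset.univ.filter (fun S' : Finset ((i : Fin n) × Fin (t i)) =>
        S'.image Sigma.fst = S ∧ (S'.image Sigma.fst).card = S'.card), ∏ x ∈ S', w x
      = ∏ i ∈ S, ∑ j, w ⟨i, j⟩ := by
  classical
  rw [Finset.prod_sum]
  symm
  have hinj : ∀ p : (∀ i ∈ S, Fin (t i)), Function.Injective
      (fun i : {x // x ∈ S} => (⟨i.1, p i.1 i.2⟩ : (i : Fin n) × Fin (t i))) := by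
    intro p a b hab
    exact Subtype.ext (congrArg Sigma.fst hab)
  refine Finset.sum_bij (fun p _ => S.attach.map ⟨_, hinj p⟩) ?_ ?_ ?_ ?_
  · intro p _
    have h : (S.attach.map ⟨_, hinj p⟩).image Sigma.fst = S := by
      ext a
      simp
    simp only [Finset.mem_filter, Finset.mem_univ, true_and]
    refine ⟨h, ?_⟩
    rw [h]; simp
  · intro p _ q _ hpq
    funext i hi
    have hm : (⟨i, p i hi⟩ : (i : Fin n) × Fin (t i)) ∈ S.attach.map ⟨_, hinj p⟩ := by
      rw [Finset.mem_map]
      exact ⟨⟨i, hi⟩, Finset.mem_attach _ _, rfl⟩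
    rw [hpq, Finset.mem_map] at hm
    obtain ⟨⟨b, hb⟩, _, h⟩ := hm
    simp only [Function.Embedding.coeFn_mk, Sigma.mk.injEq] at h
    obtain ⟨rfl, h⟩ := h
    exact (eq_of_heq h).symm
  · intro S' hS'
    simp only [Finset.mem_filter, Finset.mem_univ, true_and] at hS'
    obtain ⟨h1, h2⟩ := hS'
    have hin := Finset.card_image_iff.mp h2
    have hex : ∀ i ∈ S, ∃ j : Fin (t i), (⟨i, j⟩ : (i : Fin n) × Fin (t i)) ∈ S' := by
      intro i hi
      rw [← h1, Finset.mem_image] at hi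
      obtain ⟨⟨a, b⟩, hx, rfl⟩ := hi
      exact ⟨b, hx⟩
    choose p hp using hex
    refine ⟨p, by simp, ?_⟩
    ext x
    rw [Finset.mem_map]
    constructor
    · rintro ⟨⟨i, hi⟩, _, rfl⟩
      exact hp i hi
    · intro hx
      have hxS : x.1 ∈ S := by rw [← h1]; exact Finset.mem_image_of_mem _ hx
      exact ⟨⟨x.1, hxS⟩, Finset.mem_attach _ _, hin (hp _ hxS) hx rfl⟩
  · intro p _
    rw [Finset.prod_map]
    rfl

lemma subdivision_gen {n : ℕ} (t : Fin n → ℕ) (μ : Finset (Fin n) → ℝ)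
    (w : ((i : Fin n) × Fin (t i)) → ℝ) :
    ∑ S' : Finset ((i : Fin n) × Fin (t i)), subdivision t μ S' * ∏ x ∈ S', w x
      = ∑ S : Finset (Fin n), μ S * ∏ i ∈ S, ((∑ j, w ⟨i, j⟩) / (t i : ℝ)) := by
  classical
  rw [← Finset.sum_fiberwise Finset.univ
    (fun S' : Finset ((i : Fin n) × Fin (t i)) => S'.image Sigma.fst)]
  refine Finset.sum_congr rfl fun S _ => ?_
  rw [Finset.prod_div_distrib, ← subdivision_fiber, ← Finset.filter_filter,
    Finset.sum_filter (fun S' : Finset ((i : Fin n) × Fin (t i)) =>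
      (S'.image Sigma.fst).card = S'.card),
    Finset.sum_div, Finset.mul_sum]
  refine Finset.sum_congr rfl fun S' hS' => ?_
  have h : S'.image Sigma.fst = S := by simpa using hS'
  unfold subdivision
  rw [h]
  split_ifs
  · ring
  · simp

lemma subdivision_marginal {n : ℕ} (t : Fin n → ℕ) (ht : ∀ i, 0 < t i)
    (μ : Finset (Fin n) → ℝ) (x : (i : Fin n) × Fin (t i)) :
    ∑ S' ∈ Finset.univ.filter
        (fun S' : Finset ((i : Fin n) × Fin (t i)) => x ∈ S'), subdivision t μ S'
      = (∑ S ∈ Finset.univ.filter (fun S : Finset (Fin n) => x.1 ∈ S), μ S) / t x.1 := by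
  classical
  have ht' : ∀ i, (t i : ℝ) ≠ 0 := fun i => by exact_mod_cast (ht i).ne'
  have h1 := subdivision_gen t μ (fun _ => 1)
  have h2 := subdivision_gen t μ (fun y => if y = x then 0 else 1)
  have e : ∑ S' ∈ Finset.univ.filter
        (fun S' : Finset ((i : Fin n) × Fin (t i)) => x ∈ S'), subdivision t μ S'
      = ∑ S' : Finset ((i : Fin n) × Fin (t i)), subdivision t μ S' * ∏ x ∈ S', (1 : ℝ) -
       ∑ S' : Finset ((i : Fin n) × Fin (t i)), subdivision t μ S' *
        ∏ y ∈ S', (if y = x then (0 : ℝ) else 1) := by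
    rw [Finset.sum_filter, ← Finset.sum_sub_distrib]
    refine Finset.sum_congr rfl fun S' _ => ?_
    split_ifs with h
    · have h0 : ∏ y ∈ S', (if y = x then (0 : ℝ) else 1) = 0 :=
        Finset.prod_eq_zero h (if_pos rfl)
      rw [h0]; simp
    · have h0 : ∏ y ∈ S', (if y = x then (0 : ℝ) else 1) = 1 :=
        Finset.prod_eq_one fun y hy => if_neg (fun hyx : y = x => h (hyx ▸ hy))
      rw [h0]; simp
  rw [e, h1, h2, Finset.sum_filter, ← Finset.sum_sub_distrib, Finset.sum_div]
  refine Finset.sum_congr rfl fun S _ => ?_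
  have a1 : ∏ i ∈ S, ((∑ _j : Fin (t i), (1 : ℝ)) / (t i : ℝ)) = 1 := by
    refine Finset.prod_eq_one fun i _ => ?_
    simp [ht' i]
  have a2 : ∀ i, i ≠ x.1 → ((∑ j : Fin (t i),
      (if (⟨i, j⟩ : (i : Fin n) × Fin (t i)) = x then (0 : ℝ) else 1)) / (t i : ℝ)) = 1 := by
    intro i hi
    rw [Finset.sum_congr rfl (g := fun _ => (1 : ℝ))]
    · simp [ht' i]
    · intro j _
      rw [if_neg]
      rintro rfl
      exact hi rfl
  have a3 : ((∑ j : Fin (t x.1),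
      (if (⟨x.1, j⟩ : (i : Fin n) × Fin (t i)) = x then (0 : ℝ) else 1)) / (t x.1 : ℝ))
      = 1 - 1 / t x.1 := by
    obtain ⟨a, b⟩ := x
    have : ∀ j : Fin (t a), (if (⟨a, j⟩ : (i : Fin n) × Fin (t i)) = ⟨a, b⟩ then (0 : ℝ) else 1)
        = 1 - (if j = b then 1 else 0) := by
      intro j
      by_cases h : j = b <;> simp [h]
    simp only [this, Finset.sum_sub_distrib, Finset.sum_ite_eq', Finset.mem_univ, if_true]
    have := ht' a
    simp
    field_simp
  rw [a1]
  split_ifs with h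
  · rw [Finset.prod_eq_single_of_mem x.1 h (fun i _ hi => a2 i hi), a3]
    ring
  · rw [Finset.prod_eq_one (fun i hi => a2 i (fun hh => h (hh ▸ hi)))]
    simp

/-- Subdivision preserves `(1/α)`-entropic independence. -/
theorem subdivision_entropic_independence
    (n k : ℕ) (hk : 0 < k) (hkn : k ≤ n)
    (μ : Finset (Fin n) → ℝ)
    (hμ0 : ∀ S, 0 ≤ μ S)
    (hμcard : ∀ S : Finset (Fin n), S.card ≠ k → μ S = 0)
    (hμ1 : ∑ S : Finset (Fin n), μ S = 1)
    (α : ℝ) (hα0 : 0 < α) (hα1 : α ≤ 1)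
    -- (1/α)-entropic independence of μ
    (hEI : ∀ z : Fin n → ℝ, (∀ i, 0 ≤ z i) →
      (∑ S : Finset (Fin n), μ S * ∏ i ∈ S, z i ^ α) ^ ((1 : ℝ) / (k * α)) ≤
        ∑ i : Fin n,
          ((∑ S ∈ Finset.univ.filter (fun S : Finset (Fin n) => i ∈ S), μ S) / k) * z i)
    (t : Fin n → ℕ) (ht : ∀ i, 0 < t i) :
    -- (1/α)-entropic independence of the subdivision μ'
    ∀ z : ((i : Fin n) × Fin (t i)) → ℝ, (∀ x, 0 ≤ z x) →
      (∑ S' : Finset ((i : Fin n) × Fin (t i)),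
          subdivision t μ S' * ∏ x ∈ S', z x ^ α) ^ ((1 : ℝ) / (k * α)) ≤
        ∑ x : (i : Fin n) × Fin (t i),
          ((∑ S' ∈ Finset.univ.filter
              (fun S' : Finset ((i : Fin n) × Fin (t i)) => x ∈ S'),
            subdivision t μ S') / k) * z x := by
  intro z hz
  rw [subdivision_gen t μ (fun x => z x ^ α)]
  have ht' : ∀ i, (0 : ℝ) < t i := fun i => by exact_mod_cast ht i
  have hA : ∀ i, 0 ≤ (∑ j, z ⟨i, j⟩ ^ α) / (t i : ℝ) := fun i =>
    div_nonneg (Finset.sum_nonneg fun j _ => Real.rpow_nonneg (hz _) _) (ht' i).le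
  have key := hEI (fun i => ((∑ j, z ⟨i, j⟩ ^ α) / (t i : ℝ)) ^ (1 / α))
    (fun i => Real.rpow_nonneg (hA i) _)
  have hpow : ∀ i, (((∑ j, z ⟨i, j⟩ ^ α) / (t i : ℝ)) ^ (1 / α)) ^ α
      = (∑ j, z ⟨i, j⟩ ^ α) / (t i : ℝ) := fun i => by
    rw [← Real.rpow_mul (hA i), one_div_mul_cancel hα0.ne', Real.rpow_one]
  simp only [hpow] at key
  refine key.trans ?_
  rw [Fintype.sum_sigma]
  refine Finset.sum_le_sum fun i _ => ?_
  simp only [subdivision_marginal t ht μ]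
  have hmean : ((∑ j, z ⟨i, j⟩ ^ α) / (t i : ℝ)) ^ (1 / α) ≤ (∑ j, z ⟨i, j⟩) / (t i : ℝ) := by
    have h := Real.rpow_arith_mean_le_arith_mean_rpow (Finset.univ : Finset (Fin (t i)))
      (fun _ => 1 / (t i : ℝ)) (fun j => z ⟨i, j⟩ ^ α)
      (fun _ _ => by have := ht' i; positivity)
      (by simp [(ht' i).ne']) (fun j _ => Real.rpow_nonneg (hz _) _)
      (p := 1 / α) (by rw [le_div_iff₀ hα0]; linarith)
    have e : ∀ j, (z ⟨i, j⟩ ^ α) ^ (1 / α) = z ⟨i, j⟩ := fun j => by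
      rw [← Real.rpow_mul (hz _), mul_one_div_cancel hα0.ne', Real.rpow_one]
    simp only [e, ← Finset.mul_sum] at h
    rw [one_div_mul_eq_div, one_div_mul_eq_div] at h
    exact h
  rw [← Finset.mul_sum]
  refine (mul_le_mul_of_nonneg_left hmean ?_).trans (le_of_eq ?_)
  · exact div_nonneg (Finset.sum_nonneg fun S _ => hμ0 S) (Nat.cast_nonneg k)
  · ring
end

section
/- Let μ be an α-fractionally-log-concave probability distribution on k-subsets of [n] with α ∈ (0,1], let t₁,…,t_n be positive integers, and define the subdivided generating polynomial h((z_i^{(j)})_{i ∈ [n], j ∈ [t_i]}) := g_μ((z_1^{(1)}+…+z_1^{(t_1)})/t_1, …, (z_n^{(1)}+…+z_n^{(t_n)})/t_n). Then the function (z_i^{(j)}) ↦ log h((z_i^{(j)})^α) is concave on the positive orthant; that is, the subdivision μ' of μ is also α-fractionally-log-concave. -/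
open Finset

/-- Concavity of the power mean with exponent `α ≤ 1` (reverse Minkowski), in `α`-th power form. -/
lemma powerMean_concave (t : ℕ) (ht : 0 < t) (α : ℝ) (hα0 : 0 < α) (hα1 : α ≤ 1)
    (x y : Fin t → ℝ) (hx : ∀ j, 0 < x j) (hy : ∀ j, 0 < y j) (X Y : ℝ) (hX : 0 < X) (hY : 0 < Y)
    (hXx : X ^ α = (∑ j, x j ^ α) / t) (hYy : Y ^ α = (∑ j, y j ^ α) / t)
    (a b : ℝ) (ha : 0 ≤ a) (hb : 0 ≤ b) (hab : a + b = 1) :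
    (a * X + b * Y) ^ α ≤ (∑ j, (a * x j + b * y j) ^ α) / t := by
  have htR : (0 : ℝ) < t := by exact_mod_cast ht
  have hM : 0 < a * X + b * Y := by
    rcases ha.lt_or_eq with h | h
    · have := mul_pos h hX
      have := mul_nonneg hb hY.le
      linarith
    · have : b = 1 := by linarith
      subst h; subst this; simpa using hY
  set M := a * X + b * Y with hMdef
  have hXa : 0 < X ^ α := Real.rpow_pos_of_pos hX α
  have hYa : 0 < Y ^ α := Real.rpow_pos_of_pos hY α
  have hMa : 0 < M ^ α := Real.rpow_pos_of_pos hM α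
  have hc := Real.concaveOn_rpow hα0.le hα1
  have key : ∀ j, M ^ α * ((a * X / M) * (x j ^ α / X ^ α) + (b * Y / M) * (y j ^ α / Y ^ α))
      ≤ (a * x j + b * y j) ^ α := by
    intro j
    have h1 := hc.2 (show x j / X ∈ Set.Ici (0 : ℝ) from (div_pos (hx j) hX).le)
      (show y j / Y ∈ Set.Ici (0 : ℝ) from (div_pos (hy j) hY).le)
      (show 0 ≤ a * X / M by positivity) (show 0 ≤ b * Y / M by positivity)
      (by rw [← add_div]; exact div_self hM.ne')
    simp only [smul_eq_mul] at h1
    rw [Real.div_rpow (hx j).le hX.le, Real.div_rpow (hy j).le hY.le] at h1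
    have h2 : a * x j + b * y j = M * (a * X / M * (x j / X) + b * Y / M * (y j / Y)) := by
      field_simp
    have h3 : 0 ≤ a * X / M * (x j / X) + b * Y / M * (y j / Y) := by
      have := hx j
      have := hy j
      positivity
    rw [h2, Real.mul_rpow hM.le h3]
    exact mul_le_mul_of_nonneg_left h1 hMa.le
  rw [le_div_iff₀ htR]
  refine le_trans (le_of_eq ?_) (Finset.sum_le_sum fun j _ => key j)
  rw [← Finset.mul_sum, Finset.sum_add_distrib, ← Finset.mul_sum, ← Finset.mul_sum,
    ← Finset.sum_div, ← Finset.sum_div]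
  have e1 : ∑ j, x j ^ α = X ^ α * t := by rw [hXx]; field_simp
  have e2 : ∑ j, y j ^ α = Y ^ α * t := by rw [hYy]; field_simp
  rw [e1, e2, mul_div_cancel_left₀ _ hXa.ne', mul_div_cancel_left₀ _ hYa.ne', ← add_mul,
    ← add_div, ← hMdef, div_self hM.ne', one_mul]

/-- Subdivision preserves `α`-fractional log-concavity: if
`z ↦ log g_μ(z^α)` is concave on the positive orthant, then so is the corresponding function
for the subdivided generating polynomial
`h((z_i^{(j)})) = g_μ((Σ_j z_1^{(j)})/t_1, …, (Σ_j z_n^{(j)})/t_n)`. -/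
theorem subdivision_fractionally_log_concave
    (n k : ℕ) (hk : 0 < k) (hkn : k ≤ n)
    (μ : Finset (Fin n) → ℝ)
    (hμ0 : ∀ S, 0 ≤ μ S)
    (hμcard : ∀ S : Finset (Fin n), S.card ≠ k → μ S = 0)
    (hμ1 : ∑ S : Finset (Fin n), μ S = 1)
    (α : ℝ) (hα0 : 0 < α) (hα1 : α ≤ 1)
    -- μ is α-fractionally log-concave
    (hFLC : ConcaveOn ℝ {z : Fin n → ℝ | ∀ i, 0 < z i}
      (fun z => Real.log (∑ S : Finset (Fin n), μ S * ∏ i ∈ S, z i ^ α)))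
    (t : Fin n → ℕ) (ht : ∀ i, 0 < t i) :
    -- the subdivision μ' is α-fractionally log-concave
    ConcaveOn ℝ {z : ((i : Fin n) × Fin (t i)) → ℝ | ∀ x, 0 < z x}
      (fun z => Real.log (∑ S : Finset (Fin n),
        μ S * ∏ i ∈ S, ((∑ j : Fin (t i), z ⟨i, j⟩ ^ α) / t i))) := by
  have hpos : ∀ w : Fin n → ℝ, (∀ i, 0 < w i) →
      0 < ∑ S : Finset (Fin n), μ S * ∏ i ∈ S, w i := by
    intro w hw
    have hex : ∃ S ∈ (Finset.univ : Finset (Finset (Fin n))), 0 < μ S := by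
      by_contra hcon
      push Not at hcon
      have := Finset.sum_nonpos hcon
      linarith
    obtain ⟨S, hS, hSp⟩ := hex
    exact Finset.sum_pos' (fun T _ => mul_nonneg (hμ0 T) (Finset.prod_nonneg fun i _ => (hw i).le))
      ⟨S, hS, mul_pos hSp (Finset.prod_pos fun i _ => hw i)⟩
  have hmean : ∀ z : ((i : Fin n) × Fin (t i)) → ℝ, (∀ x, 0 < z x) → ∀ i,
      0 < (∑ j : Fin (t i), z ⟨i, j⟩ ^ α) / t i := by
    intro z hz i
    have hti : (0 : ℝ) < t i := by exact_mod_cast ht i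
    have : Nonempty (Fin (t i)) := ⟨⟨0, ht i⟩⟩
    exact div_pos (Finset.sum_pos (fun j _ => Real.rpow_pos_of_pos (hz _) _)
      Finset.univ_nonempty) hti
  have hroot : ∀ c : ℝ, 0 < c → (c ^ (α⁻¹)) ^ α = c := fun c hc =>
    Real.rpow_inv_rpow hc.le hα0.ne'
  have hconv : Convex ℝ {z : ((i : Fin n) × Fin (t i)) → ℝ | ∀ x, 0 < z x} := by
    intro x hx y hy a b ha hb hab i
    exact (convex_Ioi (0 : ℝ)) (hx i) (hy i) ha hb hab
  refine ⟨hconv, ?_⟩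
  intro x hx y hy a b ha hb hab
  have hz := hconv hx hy ha hb hab
  set X : Fin n → ℝ := fun i => ((∑ j : Fin (t i), x ⟨i, j⟩ ^ α) / t i) ^ (α⁻¹) with hXdef
  set Y : Fin n → ℝ := fun i => ((∑ j : Fin (t i), y ⟨i, j⟩ ^ α) / t i) ^ (α⁻¹) with hYdef
  have hX : ∀ i, 0 < X i := fun i => Real.rpow_pos_of_pos (hmean x hx i) _
  have hY : ∀ i, 0 < Y i := fun i => Real.rpow_pos_of_pos (hmean y hy i) _
  have hXe : ∀ i, X i ^ α = (∑ j : Fin (t i), x ⟨i, j⟩ ^ α) / t i :=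
    fun i => hroot _ (hmean x hx i)
  have hYe : ∀ i, Y i ^ α = (∑ j : Fin (t i), y ⟨i, j⟩ ^ α) / t i :=
    fun i => hroot _ (hmean y hy i)
  have hM : ∀ i, 0 < (a • X + b • Y) i := fun i =>
    (convex_Ioi (0 : ℝ)) (hX i) (hY i) ha hb hab
  have h1 := hFLC.2 (x := X) hX (y := Y) hY ha hb hab
  simp only [hXe, hYe] at h1
  refine h1.trans (Real.log_le_log (hpos _ fun i => Real.rpow_pos_of_pos (hM i) α) ?_)
  refine Finset.sum_le_sum fun S _ => mul_le_mul_of_nonneg_left ?_ (hμ0 S)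
  refine Finset.prod_le_prod (fun i _ => (Real.rpow_pos_of_pos (hM i) α).le) fun i _ => ?_
  exact powerMean_concave (t i) (ht i) α hα0 hα1 (fun j => x ⟨i, j⟩) (fun j => y ⟨i, j⟩)
    (fun j => hx _) (fun j => hy _) (X i) (Y i) (hX i) (hY i) (hXe i) (hYe i) a b ha hb hab
end

section
/- Let μ be a probability distribution on k-subsets of [n] with P_μ[i ∈ S] > 0 for every i ∈ [n]. Fix a positive integer k₁ and positive reals λ^{(1)},…,λ^{(k₁)} summing to 1, and let μ' be the distribution obtained from μ by splitting element 1 into k₁ copies with proportions λ^{(j)}: for S not containing 1, μ'(S) := μ(S); for S containing 1, μ'((S \ {1}) ∪ {1^{(j)}}) := λ^{(j)}·μ(S); and μ' assigns 0 to sets containing two copies of element 1. Then the multiset of eigenvalues of the correlation matrix Ψ_{μ'} equals the multiset of eigenvalues of Ψ_μ together with the eigenvalue 1 repeated k₁ − 1 times; in particular λ_max(Ψ_{μ'}) ≤ max(λ_max(Ψ_μ), 1). -/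
open Finset

/-- The marginal `P_μ[i]` of an element `i` under a set distribution `μ`. -/
noncomputable def marg {G : Type*} [Fintype G] [DecidableEq G] (μ : Finset G → ℝ) (i : G) : ℝ :=
  ∑ S ∈ Finset.univ.filter (fun S : Finset G => i ∈ S), μ S

/-- The correlation matrix `Ψ_μ` of a set distribution `μ`:
`Ψ_μ(i,i) = 1 − P_μ[i]` and `Ψ_μ(i,j) = P_μ[j | i] − P_μ[j]` for `j ≠ i`. -/
noncomputable def corrMatrix {G : Type*} [Fintype G] [DecidableEq G] (μ : Finset G → ℝ) :
    Matrix G G ℝ := fun i j =>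
  if j = i then 1 - marg μ i
  else (∑ S ∈ Finset.univ.filter (fun S : Finset G => i ∈ S ∧ j ∈ S), μ S) / marg μ i -
    marg μ j

/-- the projection collapsing the copies of `e` -/
abbrev splitProj {n k₁ : ℕ} (e : Fin n) : Fin k₁ ⊕ {i : Fin n // i ≠ e} → Fin n :=
  Sum.elim (fun _ => e) (fun x => x.1)

/-- the weight of an element of the split ground set -/
abbrev splitW {n k₁ : ℕ} (e : Fin n) (l : Fin k₁ → ℝ) : Fin k₁ ⊕ {i : Fin n // i ≠ e} → ℝ :=
  Sum.elim (fun j => l j) (fun _ => (1 : ℝ))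

/-- compatibility of an element with the choice of the copy `j` -/
def splitC {n k₁ : ℕ} (e : Fin n) (x : Fin k₁ ⊕ {i : Fin n // i ≠ e}) (j : Fin k₁) : Prop :=
  ∀ a, x = Sum.inl a → a = j

/-- the lift of a set using the copy `j` -/
noncomputable def splitLift {n k₁ : ℕ} (e : Fin n) (j : Fin k₁) (S : Finset (Fin n)) :
    Finset (Fin k₁ ⊕ {i : Fin n // i ≠ e}) := by
  classical
  exact Finset.univ.filter (fun x => splitProj e x ∈ S ∧ splitC e x j)

lemma mem_splitLift {n k₁ : ℕ} (e : Fin n) (j : Fin k₁) (S : Finset (Fin n)) (x) :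
    x ∈ splitLift e j S ↔ splitProj e x ∈ S ∧ splitC e x j := by
  simp [splitLift]

lemma splitLift_eq_iff {n k₁ : ℕ} (e : Fin n) (j : Fin k₁) (S : Finset (Fin n))
    (S' : Finset (Fin k₁ ⊕ {i : Fin n // i ≠ e})) :
    splitLift e j S = S' ↔ S = S'.image (splitProj e) ∧ ∀ x ∈ S', splitC e x j := by
  constructor
  · rintro rfl
    refine ⟨?_, fun x hx => ((mem_splitLift e j S x).1 hx).2⟩
    ext i
    simp only [Finset.mem_image, mem_splitLift]
    constructor
    · intro hi
      by_cases h : i = e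
      · subst h
        exact ⟨Sum.inl j, ⟨hi, fun j' h => (Sum.inl.inj h).symm⟩, rfl⟩
      · exact ⟨Sum.inr ⟨i, h⟩, ⟨hi, fun j' h => by cases h⟩, rfl⟩
    · rintro ⟨x, ⟨h, _⟩, rfl⟩
      exact h
  · rintro ⟨rfl, h⟩
    ext x
    rw [mem_splitLift]
    constructor
    · rintro ⟨h1, h2⟩
      obtain ⟨y, hy, hyx⟩ := Finset.mem_image.1 h1
      have h3 := h y hy
      rcases x with x | x <;> rcases y with y | y
      · have := h2 x rfl
        have := h3 y rfl
        simp_all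
      · exact absurd hyx y.2
      · exact absurd hyx.symm x.2
      · have : y = x := Subtype.ext hyx
        rwa [← this]
    · intro hx
      exact ⟨Finset.mem_image_of_mem _ hx, h x hx⟩

open Classical in
lemma split_weight {n k₁ : ℕ} (e : Fin n) (l : Fin k₁ → ℝ) (hlsum : ∑ j, l j = 1)
    (S' : Finset (Fin k₁ ⊕ {i : Fin n // i ≠ e})) :
    (∑ j, if (∀ x ∈ S', splitC e x j) then l j else 0) =
      if (S'.image (splitProj e)).card = S'.card then ∏ x ∈ S', splitW e l x else 0 := by
  by_cases h0 : ∃ j₀, Sum.inl j₀ ∈ S'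
  · obtain ⟨j₀, hj₀⟩ := h0
    by_cases h1 : ∀ j₁, Sum.inl j₁ ∈ S' → j₁ = j₀
    · have hc : (S'.image (splitProj e)).card = S'.card := by
        apply Finset.card_image_of_injOn
        intro x hx y hy hxy
        rcases x with x | x <;> rcases y with y | y
        · rw [h1 x hx, h1 y hy]
        · exact absurd hxy.symm y.2
        · exact absurd hxy x.2
        · exact congrArg Sum.inr (Subtype.ext hxy)
      rw [if_pos hc, Finset.prod_eq_single (Sum.inl j₀), Finset.sum_eq_single j₀]
      · rw [if_pos]
        · rfl
        · rintro x hx j' rfl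
          exact h1 _ hx
      · intro j _ hj
        rw [if_neg]
        intro h
        exact hj (h _ hj₀ j₀ rfl).symm
      · simp
      · rintro (x | x) hx hne
        · exact absurd (congrArg Sum.inl (h1 x hx)) hne
        · rfl
      · intro h; exact absurd hj₀ h
    · push Not at h1
      obtain ⟨j₁, hj₁, hne⟩ := h1
      rw [if_neg]
      · apply Finset.sum_eq_zero
        intro j _
        rw [if_neg]
        intro h
        exact hne ((h _ hj₁ j₁ rfl).trans (h _ hj₀ j₀ rfl).symm)
      · intro h
        have := Finset.card_image_iff.1 h hj₁ hj₀ rfl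
        exact hne (Sum.inl.inj this)
  · push Not at h0
    have hc : (S'.image (splitProj e)).card = S'.card := by
      apply Finset.card_image_of_injOn
      intro x hx y hy hxy
      rcases x with x | x
      · exact absurd hx (h0 x)
      rcases y with y | y
      · exact absurd hy (h0 y)
      · exact congrArg Sum.inr (Subtype.ext hxy)
    rw [if_pos hc, Finset.prod_eq_one, ← hlsum]
    · apply Finset.sum_congr rfl
      intro j _
      rw [if_pos]
      rintro x hx j' rfl
      exact absurd hx (h0 j')
    · rintro (x | x) hx
      · exact absurd hx (h0 x)
      · rfl

open Classical in
lemma split_sum {n k₁ : ℕ} (μ : Finset (Fin n) → ℝ) (e : Fin n)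
    (l : Fin k₁ → ℝ) (hlsum : ∑ j, l j = 1)
    (μ' : Finset (Fin k₁ ⊕ {i : Fin n // i ≠ e}) → ℝ)
    (hμ'def : ∀ S' : Finset (Fin k₁ ⊕ {i : Fin n // i ≠ e}),
      μ' S' =
        if (S'.image (splitProj e)).card = S'.card then
          μ (S'.image (splitProj e)) * ∏ x ∈ S', splitW e l x
        else 0)
    (P : Finset (Fin k₁ ⊕ {i : Fin n // i ≠ e}) → Prop) :
    ∑ S' ∈ Finset.univ.filter P, μ' S' =
      ∑ S, μ S * ∑ j, if P (splitLift e j S) then l j else 0 := by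
  have h1 : ∀ S', μ' S' = ∑ S, ∑ j, if splitLift e j S = S' then μ S * l j else 0 := by
    intro S'
    rw [Finset.sum_eq_single (S'.image (splitProj e))]
    · rw [hμ'def, ← mul_ite_zero, ← split_weight e l hlsum, Finset.mul_sum]
      apply Finset.sum_congr rfl
      intro j _
      simp only [splitLift_eq_iff, true_and, mul_ite_zero]
    · intro S _ hS
      apply Finset.sum_eq_zero
      intro j _
      rw [if_neg]
      rw [splitLift_eq_iff]
      exact fun h => hS h.1
    · simp
  simp_rw [h1]
  rw [Finset.sum_comm]
  apply Finset.sum_congr rfl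
  intro S _
  rw [Finset.sum_comm, Finset.mul_sum]
  apply Finset.sum_congr rfl
  intro j _
  rw [Finset.sum_ite_eq]
  simp

lemma charpoly_one_add {G : Type*} [Fintype G] [DecidableEq G] (M : Matrix G G ℝ) :
    (M + 1).charpoly = M.charpoly.comp (Polynomial.X - 1) := by
  have h : (Polynomial.X - 1 : Polynomial ℝ) = Polynomial.X - Polynomial.C 1 := by simp
  rw [Matrix.charpoly, Matrix.charpoly, h, ← Polynomial.coe_compRingHom_apply, RingHom.map_det]
  congr 1
  ext i j : 2
  by_cases hij : i = j
  · subst hij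
    simp [Matrix.charmatrix]
    ring
  · simp [Matrix.charmatrix, hij]

open Classical in
lemma split_entry {n k₁ : ℕ} (μ : Finset (Fin n) → ℝ) (hmargpos : ∀ i : Fin n, 0 < marg μ i)
    (e : Fin n)
    (l : Fin k₁ → ℝ) (hl : ∀ j, 0 < l j) (hlsum : ∑ j, l j = 1)
    (μ' : Finset (Fin k₁ ⊕ {i : Fin n // i ≠ e}) → ℝ)
    (hμ'def : ∀ S' : Finset (Fin k₁ ⊕ {i : Fin n // i ≠ e}),
      μ' S' =
        if (S'.image (splitProj e)).card = S'.card then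
          μ (S'.image (splitProj e)) * ∏ x ∈ S', splitW e l x
        else 0) (x y : Fin k₁ ⊕ {i : Fin n // i ≠ e}) :
    (corrMatrix μ' - 1) x y =
      (corrMatrix μ - 1) (splitProj e x) (splitProj e y) * splitW e l y := by
  have hC : ∀ x, (∑ j, if splitC e x j then l j else 0) = splitW e l x := by
    rintro (x | x)
    · simp [splitC]
    · simpa [splitC] using hlsum
  have hm : ∀ x, marg μ' x = marg μ (splitProj e x) * splitW e l x := by
    intro x
    have := split_sum μ e l hlsum μ' hμ'def (fun S => x ∈ S)
    unfold marg
    refine Eq.trans (by congr!) (this.trans (Eq.symm ?_))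
    rw [Finset.sum_mul, Finset.sum_filter]
    apply Finset.sum_congr rfl
    intro S _
    simp only [mem_splitLift]
    by_cases h : splitProj e x ∈ S
    · simp only [h, true_and, if_true, hC]
    · simp only [h, false_and, if_false, Finset.sum_const_zero, mul_zero]
  have hw : 0 < splitW e l x := by
    rcases x with x | x
    · exact hl x
    · exact one_pos
  have hp := hmargpos (splitProj e x)
  by_cases hxy : y = x
  · subst hxy
    simp only [Matrix.sub_apply, Matrix.one_apply_eq, corrMatrix, if_true, hm]
    ring
  have hj : (∑ S ∈ Finset.univ.filter (fun S => x ∈ S ∧ y ∈ S), μ' S) =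
      ∑ S, μ S * (if splitProj e x ∈ S ∧ splitProj e y ∈ S then
        (∑ j, if splitC e x j ∧ splitC e y j then l j else 0) else 0) := by
    have := split_sum μ e l hlsum μ' hμ'def (fun S => x ∈ S ∧ y ∈ S)
    refine Eq.trans (by congr!) (this.trans (Eq.symm ?_))
    apply Finset.sum_congr rfl
    intro S _
    simp only [mem_splitLift]
    by_cases h : splitProj e x ∈ S ∧ splitProj e y ∈ S
    · simp only [h, true_and, if_true]
    · rw [if_neg h]
      congr 1
      symm
      apply Finset.sum_eq_zero
      intro j _
      rw [if_neg]
      tauto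
  by_cases hpi : splitProj e y = splitProj e x
  · -- both are copies of `e`
    have hz : (∑ j, if splitC e x j ∧ splitC e y j then l j else 0) = 0 := by
      rcases x with x | x <;> rcases y with y | y
      · apply Finset.sum_eq_zero
        intro j _
        rw [if_neg]
        rintro ⟨h1, h2⟩
        exact hxy (congrArg Sum.inl ((h2 y rfl).trans (h1 x rfl).symm))
      · exact absurd hpi y.2
      · exact absurd hpi.symm x.2
      · exact absurd (congrArg Sum.inr (Subtype.ext hpi)) hxy
    rw [hz] at hj
    simp only [ite_self, mul_zero, Finset.sum_const_zero] at hj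
    simp only [Matrix.sub_apply, Matrix.one_apply, corrMatrix, hm, hxy, Ne.symm hxy, if_false, hj,
      hpi, if_true]
    ring
  · have hz : (∑ j, if splitC e x j ∧ splitC e y j then l j else 0) =
        splitW e l x * splitW e l y := by
      rcases x with x | x <;> rcases y with y | y
      · exact absurd rfl hpi
      · simp [splitC]
      · simp [splitC]
      · simpa [splitC] using hlsum
    have hj2 : (∑ S ∈ Finset.univ.filter (fun S => x ∈ S ∧ y ∈ S), μ' S) =
        (∑ S ∈ Finset.univ.filter (fun S => splitProj e x ∈ S ∧ splitProj e y ∈ S), μ S) *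
          (splitW e l x * splitW e l y) := by
      rw [hj, hz, Finset.sum_filter, Finset.sum_mul]
      apply Finset.sum_congr rfl
      intro S _
      split_ifs <;> simp
    have e1 : (corrMatrix μ' - 1) x y =
        (∑ S ∈ Finset.univ.filter (fun S => x ∈ S ∧ y ∈ S), μ' S) / marg μ' x - marg μ' y := by
      rw [Matrix.sub_apply, Matrix.one_apply_ne (Ne.symm hxy), sub_zero, corrMatrix, if_neg hxy]
    have e2 : (corrMatrix μ - 1) (splitProj e x) (splitProj e y) =
        (∑ S ∈ Finset.univ.filter (fun S => splitProj e x ∈ S ∧ splitProj e y ∈ S), μ S) /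
          marg μ (splitProj e x) - marg μ (splitProj e y) := by
      rw [Matrix.sub_apply, Matrix.one_apply_ne (Ne.symm hpi), sub_zero, corrMatrix, if_neg hpi]
    rw [e1, e2, hj2, hm, hm]
    generalize splitW e l x = a at *
    generalize splitW e l y = b at *
    generalize marg μ (splitProj e x) = p at *
    field_simp

/-- Splitting an element `e` of the ground set into `k₁` copies with
proportions `l₁,…,l_{k₁}` (summing to `1`) changes the spectrum of the correlation matrix
only by adding the eigenvalue `1` with multiplicity `k₁ − 1`: the characteristic polynomial
gets multiplied by `(X − 1)^{k₁−1}`; in particular every eigenvalue of `Ψ_{μ'}` is either `1`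
or an eigenvalue of `Ψ_μ`, so `λ_max(Ψ_{μ'}) ≤ max (λ_max(Ψ_μ)) 1`. -/
theorem split_element_correlation_spectrum
    (n k k₁ : ℕ) (hk : 0 < k) (hkn : k ≤ n) (hk₁ : 0 < k₁)
    (μ : Finset (Fin n) → ℝ)
    (hμ0 : ∀ S, 0 ≤ μ S)
    (hμcard : ∀ S : Finset (Fin n), S.card ≠ k → μ S = 0)
    (hμ1 : ∑ S : Finset (Fin n), μ S = 1)
    (hmargpos : ∀ i : Fin n, 0 < marg μ i)
    (e : Fin n)
    (l : Fin k₁ → ℝ) (hl : ∀ j, 0 < l j) (hlsum : ∑ j, l j = 1)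
    -- μ' : the distribution obtained from μ by splitting the element `e` into k₁ copies
    -- with proportions l; ground set {e⁽¹⁾,…,e⁽ᵏ¹⁾} ∪ ([n] \ {e}).
    (μ' : Finset (Fin k₁ ⊕ {i : Fin n // i ≠ e}) → ℝ)
    (hμ'def : ∀ S' : Finset (Fin k₁ ⊕ {i : Fin n // i ≠ e}),
      μ' S' =
        if (S'.image (Sum.elim (fun _ => e) (fun x => x.1))).card = S'.card then
          μ (S'.image (Sum.elim (fun _ => e) (fun x => x.1))) *
            ∏ x ∈ S', Sum.elim (fun j => l j) (fun _ => (1 : ℝ)) x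
        else 0) :
    (corrMatrix μ').charpoly = (corrMatrix μ).charpoly * (Polynomial.X - 1) ^ (k₁ - 1) ∧
      (∀ c : ℝ, (corrMatrix μ').charpoly.IsRoot c →
        c = 1 ∨ (corrMatrix μ).charpoly.IsRoot c) := by
  have hent := split_entry μ hmargpos e l hl hlsum μ' hμ'def
  have key : (corrMatrix μ').charpoly =
      (corrMatrix μ).charpoly * (Polynomial.X - 1) ^ (k₁ - 1) := by
    set U : Matrix (Fin k₁ ⊕ {i : Fin n // i ≠ e}) (Fin n) ℝ :=
      fun x i => if splitProj e x = i then 1 else 0 with hU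
    set V : Matrix (Fin n) (Fin k₁ ⊕ {i : Fin n // i ≠ e}) ℝ :=
      fun i x => if splitProj e x = i then splitW e l x else 0 with hV
    have hVU : V * U = 1 := by
      ext i j
      rw [Matrix.mul_apply, Fintype.sum_sum_type]
      have u1 : ∀ a i, U (Sum.inl a) i = if e = i then 1 else 0 := fun _ _ => rfl
      have u2 : ∀ a i, U (Sum.inr a) i = if a.1 = i then 1 else 0 := fun _ _ => rfl
      have v1 : ∀ a i, V i (Sum.inl a) = if e = i then l a else 0 := fun _ _ => rfl
      have v2 : ∀ a i, V i (Sum.inr a) = if a.1 = i then 1 else 0 := fun _ _ => rfl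
      by_cases hij : i = j
      · subst hij
        rw [Matrix.one_apply_eq]
        simp only [u1, u2, v1, v2]
        by_cases hi : e = i
        · subst hi
          simp only [if_true, mul_one, hlsum]
          rw [Finset.sum_eq_zero, add_zero]
          intro x _
          rw [if_neg x.2, zero_mul]
        · simp only [if_neg hi, mul_zero, Finset.sum_const_zero, zero_add]
          rw [Finset.sum_eq_single (⟨i, Ne.symm hi⟩ : {i : Fin n // i ≠ e})]
          · simp
          · intro x _ hx
            rw [if_neg (fun h => hx (Subtype.ext h)), zero_mul]
          · simp
      · rw [Matrix.one_apply_ne hij, ← Fintype.sum_sum_type (fun x => V i x * U x j)]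
        apply Finset.sum_eq_zero
        intro x _
        simp only [hU, hV]
        split_ifs with h1 h2
        · exact absurd (h1.symm.trans h2) hij
        all_goals simp
    have hfac : corrMatrix μ' - 1 = U * ((corrMatrix μ - 1) * V) := by
      ext x y
      rw [hent, Matrix.mul_apply, Finset.sum_eq_single (splitProj e x), Matrix.mul_apply,
        Finset.sum_eq_single (splitProj e y)]
      · simp [hU, hV]
      · intro i _ hi
        simp only [hV, if_neg (Ne.symm hi), mul_zero]
      · simp
      · intro i _ hi
        simp only [hU, if_neg (Ne.symm hi), zero_mul]
      · simp
    have hcp := Matrix.charpoly_mul_comm' U ((corrMatrix μ - 1) * V)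
    rw [← hfac, Matrix.mul_assoc, hVU, Matrix.mul_one] at hcp
    have hn : 0 < n := lt_of_lt_of_le hk hkn
    have hcard : Fintype.card (Fin k₁ ⊕ {i : Fin n // i ≠ e}) = n + (k₁ - 1) := by
      rw [Fintype.card_sum, Fintype.card_fin, Fintype.card_subtype_compl]
      simp
      omega
    rw [hcard, Fintype.card_fin, pow_add, mul_assoc] at hcp
    have hcp2 := mul_left_cancel₀ (pow_ne_zero n Polynomial.X_ne_zero) hcp
    have h1 := charpoly_one_add (corrMatrix μ' - 1)
    have h2 := charpoly_one_add (corrMatrix μ - 1)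
    rw [sub_add_cancel] at h1 h2
    rw [h1, h2, hcp2]
    simp [mul_comm]
  refine ⟨key, fun c hc => ?_⟩
  rw [key, Polynomial.IsRoot, Polynomial.eval_mul, mul_eq_zero] at hc
  rcases hc with hc | hc
  · exact Or.inr hc
  · left
    rw [Polynomial.eval_pow] at hc
    have h3 := eq_zero_of_pow_eq_zero hc
    simp at h3
    linarith
end

section
/- Let μ be a probability distribution on k-subsets of [n] and let ℓ be an integer with 1 ≤ ℓ ≤ k. Suppose that μD_{k→ℓ} is 1-entropically independent in the KL sense: for every probability distribution ν' on ℓ-subsets of [n] that is absolutely continuous with respect to μD_{k→ℓ}, D_KL(ν'D_{ℓ→1} ‖ (μD_{k→ℓ})D_{ℓ→1}) ≤ (1/ℓ)·D_KL(ν' ‖ μD_{k→ℓ}). Then μ is (k/ℓ)-entropically independent in the KL sense: for every probability distribution ν on k-subsets of [n] absolutely continuous with respect to μ, D_KL(νD_{k→1} ‖ μD_{k→1}) ≤ (1/ℓ)·D_KL(ν ‖ μ). -/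
open Finset

/-- The down operator `D_{a→b}` applied to a measure `ν` supported on `a`-subsets of `[n]`:
`(νD_{a→b})(T) = Σ_{S ⊇ T, |S| = a} ν(S)/C(a,b)` for `|T| = b`, and `0` otherwise. -/
noncomputable def down {n : ℕ} (a b : ℕ) (ν : Finset (Fin n) → ℝ) : Finset (Fin n) → ℝ :=
  fun T =>
    if T.card = b then
      (∑ S ∈ Finset.univ.filter (fun S : Finset (Fin n) => T ⊆ S ∧ S.card = a), ν S) /
        (Nat.choose a b : ℝ)
    else 0

/-- The KL divergence `D_KL(ν ‖ μ) = Σ_x ν(x)·log(ν(x)/μ(x))`. -/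
noncomputable def KLdiv {n : ℕ} (ν μ : Finset (Fin n) → ℝ) : ℝ :=
  ∑ S : Finset (Fin n), ν S * Real.log (ν S / μ S)

/-- The log-sum inequality. -/
lemma log_sum_ineq {ι : Type*} (s : Finset ι) (a b : ι → ℝ) (ha : ∀ i ∈ s, 0 ≤ a i)
    (hb : ∀ i ∈ s, 0 ≤ b i) (hab : ∀ i ∈ s, b i = 0 → a i = 0) :
    (∑ i ∈ s, a i) * Real.log ((∑ i ∈ s, a i) / ∑ i ∈ s, b i) ≤
      ∑ i ∈ s, a i * Real.log (a i / b i) := by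
  by_cases hA : ∑ i ∈ s, a i = 0
  · have h0 := (Finset.sum_eq_zero_iff_of_nonneg ha).1 hA
    rw [hA, zero_mul]
    apply Finset.sum_nonneg
    intro i hi
    simp [h0 i hi]
  have hApos : 0 < ∑ i ∈ s, a i := lt_of_le_of_ne (Finset.sum_nonneg ha) (Ne.symm hA)
  have hB : ∑ i ∈ s, b i ≠ 0 := by
    intro hB
    have h0 := (Finset.sum_eq_zero_iff_of_nonneg hb).1 hB
    exact hA (Finset.sum_eq_zero fun i hi => hab i hi (h0 i hi))
  have hBpos : 0 < ∑ i ∈ s, b i := lt_of_le_of_ne (Finset.sum_nonneg hb) (Ne.symm hB)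
  set A := ∑ i ∈ s, a i with hAdef
  set B := ∑ i ∈ s, b i with hBdef
  have key : ∀ i ∈ s, a i * Real.log (A / B) + (a i - b i * (A / B)) ≤
      a i * Real.log (a i / b i) := by
    intro i hi
    by_cases hai : a i = 0
    · have : 0 ≤ b i * (A / B) := mul_nonneg (hb i hi) (by positivity)
      simp [hai]; exact this
    have hap : 0 < a i := lt_of_le_of_ne (ha i hi) (Ne.symm hai)
    have hbp : 0 < b i := lt_of_le_of_ne (hb i hi) (fun h => hai (hab i hi h.symm))
    have h1 := Real.log_le_sub_one_of_pos (x := (A / B) / (a i / b i)) (by positivity)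
    rw [Real.log_div (by positivity) (by positivity)] at h1
    have h2 := mul_le_mul_of_nonneg_left h1 hap.le
    have h3 : a i * ((A / B) / (a i / b i) - 1) = b i * (A / B) - a i := by
      field_simp
    rw [h3] at h2
    nlinarith
  have h := Finset.sum_le_sum key
  rw [Finset.sum_add_distrib, Finset.sum_sub_distrib, ← Finset.sum_mul, ← Finset.sum_mul,
    ← hAdef, ← hBdef, mul_div_cancel₀ _ hB] at h
  linarith

/-- The kernel of the down operator. -/
noncomputable def downK {n : ℕ} (a b : ℕ) (S T : Finset (Fin n)) : ℝ :=
  if T.card = b ∧ T ⊆ S ∧ S.card = a then (1 : ℝ) / (Nat.choose a b : ℝ) else 0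

lemma downK_nonneg {n : ℕ} (a b : ℕ) (S T : Finset (Fin n)) : 0 ≤ downK a b S T := by
  unfold downK; split_ifs <;> positivity

lemma down_eq {n : ℕ} (a b : ℕ) (ν : Finset (Fin n) → ℝ) (T : Finset (Fin n)) :
    down a b ν T = ∑ S, downK a b S T * ν S := by
  unfold down downK
  by_cases h : T.card = b
  · simp only [h, if_true, true_and]
    rw [Finset.sum_div, Finset.sum_filter]
    apply Finset.sum_congr rfl
    intro S _
    split_ifs <;> ring
  · simp [h]

lemma downK_sum {n : ℕ} {a b : ℕ} (hab : b ≤ a) (S : Finset (Fin n)) (hS : S.card = a) :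
    ∑ T, downK a b S T = 1 := by
  unfold downK
  rw [← Finset.sum_filter, Finset.sum_const]
  have : (Finset.univ.filter fun T : Finset (Fin n) => T.card = b ∧ T ⊆ S ∧ S.card = a)
      = Finset.powersetCard b S := by
    ext T; simp [Finset.mem_powersetCard, hS, and_comm]
  rw [this, Finset.card_powersetCard, hS]
  have := Nat.choose_pos hab
  have h : ((a.choose b : ℕ) : ℝ) ≠ 0 := by positivity
  simp [h]

lemma card_aux {n : ℕ} {k l : ℕ} (S : Finset (Fin n)) (hS : S.card = k + 1) (u : Fin n)
    (hu : u ∈ S) : ((Finset.powersetCard (l + 1) S).filter (fun T => u ∈ T)).card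
      = k.choose l := by
  have h := Finset.card_filter_add_card_filter_not (s := Finset.powersetCard (l + 1) S) (fun T => u ∈ T)
  have h2 : (Finset.powersetCard (l + 1) S).filter (fun T => ¬ u ∈ T)
      = Finset.powersetCard (l + 1) (S.erase u) := by
    ext T
    simp only [Finset.mem_filter, Finset.mem_powersetCard, Finset.subset_erase]
    tauto
  rw [h2, Finset.card_powersetCard, Finset.card_powersetCard, Finset.card_erase_of_mem hu, hS,
    Nat.choose_succ_succ] at h
  simp only [Nat.add_sub_cancel] at h
  simp only [Nat.succ_eq_add_one] at h
  omega

lemma downK_comp {n : ℕ} {k l : ℕ} (hl : 1 ≤ l) (hlk : l ≤ k) (S U : Finset (Fin n)) :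
    ∑ T, downK l 1 T U * downK k l S T = downK k 1 S U := by
  by_cases hU : U.card = 1
  swap
  · simp [downK, hU]
  by_cases hS : S.card = k
  swap
  · simp [downK, hS]
  obtain ⟨u, rfl⟩ := Finset.card_eq_one.1 hU
  obtain ⟨l, rfl⟩ : ∃ m, l = m + 1 := ⟨l - 1, by omega⟩
  obtain ⟨k, rfl⟩ : ∃ m, k = m + 1 := ⟨k - 1, by omega⟩
  have h1 : ∀ T, downK (l+1) 1 T {u} * downK (k+1) (l+1) S T =
      if T ∈ (Finset.powersetCard (l + 1) S).filter (fun T => u ∈ T) then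
        1 / ((l+1 : ℕ) : ℝ) * (1 / (((k+1).choose (l+1) : ℕ) : ℝ)) else 0 := by
    intro T
    simp only [downK, Finset.card_singleton, Finset.singleton_subset_iff, hS, Finset.mem_filter,
      Finset.mem_powersetCard, Nat.choose_one_right]
    by_cases a1 : T.card = l + 1 <;> by_cases a2 : T ⊆ S <;> by_cases a3 : u ∈ T <;>
      simp [a1, a2, a3]
  simp_rw [h1]
  rw [Finset.sum_ite_mem, Finset.univ_inter, Finset.sum_const]
  by_cases hu : u ∈ S
  · rw [card_aux S hS u hu]
    have h3 := Nat.add_one_mul_choose_eq k l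
    have h4 := Nat.choose_pos hlk
    have h5 : (((k+1).choose (l+1) : ℕ) : ℝ) ≠ 0 := by positivity
    have h6 : ((k + 1 : ℕ) : ℝ) * (k.choose l : ℝ) = ((k+1).choose (l+1) : ℝ) * ((l+1 : ℕ) : ℝ) := by
      exact_mod_cast h3
    simp only [downK, Finset.card_singleton, Finset.singleton_subset_iff, hS, hu,
      Nat.choose_one_right, and_self, if_true, nsmul_eq_mul]
    have h7 : ((k + 1 : ℕ) : ℝ) ≠ 0 := by positivity
    have h8 : ((l + 1 : ℕ) : ℝ) ≠ 0 := by positivity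
    field_simp
    linarith
  · have : (Finset.powersetCard (l + 1) S).filter (fun T => u ∈ T) = ∅ := by
      ext T
      simp only [Finset.mem_filter, Finset.mem_powersetCard, Finset.notMem_empty, iff_false]
      rintro ⟨⟨h, _⟩, h'⟩
      exact hu (h h')
    simp [this, downK, hu]

lemma down_comp {n : ℕ} {k l : ℕ} (hl : 1 ≤ l) (hlk : l ≤ k) (ν : Finset (Fin n) → ℝ) :
    down l 1 (down k l ν) = down k 1 ν := by
  funext U
  simp only [down_eq, Finset.mul_sum]
  rw [Finset.sum_comm]
  apply Finset.sum_congr rfl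
  intro S _
  rw [← downK_comp hl hlk, Finset.sum_mul]
  exact Finset.sum_congr rfl fun T _ => by ring

/-- Data processing inequality for the down operator. -/
lemma KL_down_le {n : ℕ} {k l : ℕ} (hlk : l ≤ k) (ν μ : Finset (Fin n) → ℝ)
    (hν0 : ∀ S, 0 ≤ ν S) (hμ0 : ∀ S, 0 ≤ μ S)
    (hνcard : ∀ S : Finset (Fin n), S.card ≠ k → ν S = 0)
    (hac : ∀ S, μ S = 0 → ν S = 0) :
    KLdiv (down k l ν) (down k l μ) ≤ KLdiv ν μ := by
  unfold KLdiv
  calc ∑ T, down k l ν T * Real.log (down k l ν T / down k l μ T)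
      ≤ ∑ T, ∑ S, downK k l S T * (ν S * Real.log (ν S / μ S)) := by
        apply Finset.sum_le_sum
        intro T _
        rw [down_eq, down_eq]
        refine (log_sum_ineq _ _ _ ?_ ?_ ?_).trans (le_of_eq ?_)
        · exact fun S _ => mul_nonneg (downK_nonneg _ _ _ _) (hν0 S)
        · exact fun S _ => mul_nonneg (downK_nonneg _ _ _ _) (hμ0 S)
        · intro S _ h
          rcases mul_eq_zero.1 h with h | h
          · simp [h]
          · simp [hac S h]
        · apply Finset.sum_congr rfl
          intro S _
          by_cases h : downK k l S T = 0
          · simp [h]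
          · rw [mul_div_mul_left _ _ h, mul_assoc]
    _ = ∑ S, ν S * Real.log (ν S / μ S) := by
        rw [Finset.sum_comm]
        apply Finset.sum_congr rfl
        intro S _
        rw [← Finset.sum_mul]
        by_cases hS : S.card = k
        · rw [downK_sum hlk S hS, one_mul]
        · simp [hνcard S hS]

/-- If `μD_{k→ℓ}` is `1`-entropically independent (in the KL sense), then
`μ` is `(k/ℓ)`-entropically independent (in the KL sense). -/
theorem entropic_independence_from_down_level
    (n k ℓ : ℕ) (hk : 0 < k) (hkn : k ≤ n) (hℓ1 : 1 ≤ ℓ) (hℓk : ℓ ≤ k)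
    (μ : Finset (Fin n) → ℝ)
    (hμ0 : ∀ S, 0 ≤ μ S)
    (hμcard : ∀ S : Finset (Fin n), S.card ≠ k → μ S = 0)
    (hμ1 : ∑ S : Finset (Fin n), μ S = 1)
    -- μ D_{k→ℓ} is 1-entropically independent in the KL sense
    (hEI : ∀ ν' : Finset (Fin n) → ℝ,
      (∀ T, 0 ≤ ν' T) → (∀ T : Finset (Fin n), T.card ≠ ℓ → ν' T = 0) →
      (∑ T : Finset (Fin n), ν' T = 1) →
      (∀ T, down k ℓ μ T = 0 → ν' T = 0) →
      KLdiv (down ℓ 1 ν') (down ℓ 1 (down k ℓ μ)) ≤ (1 / ℓ : ℝ) * KLdiv ν' (down k ℓ μ)) :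
    -- μ is (k/ℓ)-entropically independent in the KL sense
    ∀ ν : Finset (Fin n) → ℝ,
      (∀ S, 0 ≤ ν S) → (∀ S : Finset (Fin n), S.card ≠ k → ν S = 0) →
      (∑ S : Finset (Fin n), ν S = 1) →
      (∀ S, μ S = 0 → ν S = 0) →
      KLdiv (down k 1 ν) (down k 1 μ) ≤ (1 / ℓ : ℝ) * KLdiv ν μ := by
  intro ν hν0 hνcard hν1 hac
  have h := hEI (down k ℓ ν) ?_ ?_ ?_ ?_
  · rw [down_comp hℓ1 hℓk, down_comp hℓ1 hℓk] at h
    exact h.trans (mul_le_mul_of_nonneg_left (KL_down_le hℓk ν μ hν0 hμ0 hνcard hac)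
      (by positivity))
  · intro T
    rw [down_eq]
    exact Finset.sum_nonneg fun S _ => mul_nonneg (downK_nonneg _ _ _ _) (hν0 S)
  · intro T hT
    simp [down, hT]
  · simp only [down_eq]
    rw [Finset.sum_comm, ← hν1]
    apply Finset.sum_congr rfl
    intro S _
    rw [← Finset.sum_mul]
    by_cases hS : S.card = k
    · rw [downK_sum hℓk S hS, one_mul]
    · simp [hνcard S hS]
  · intro T hT
    rw [down_eq] at hT ⊢
    rw [Finset.sum_eq_zero_iff_of_nonneg
      (fun S _ => mul_nonneg (downK_nonneg _ _ _ _) (hμ0 S))] at hT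
    apply Finset.sum_eq_zero
    intro S hS
    rcases mul_eq_zero.1 (hT S hS) with h | h
    · simp [h]
    · simp [hac S h]
end

section
/- Let μ be a probability distribution on k-subsets of [n], let t be an integer with k ≤ t ≤ n, and let S₀ be a state with |S₀| = k and μ(S₀) > 0. Let S₁ be the output of one step of the Markov chain M^t_μ from S₀. Then for every θ > 0: P[μ(S₁) ≤ θ] ≤ 2ⁿ·θ/μ(S₀). -/
open Finset

/-- For one step `S₁` of the Markov chain `M^t_μ` started at `S₀`,
`P[μ(S₁) ≤ θ] ≤ 2ⁿ·θ/μ(S₀)` for every `θ > 0`. -/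
theorem low_probability_output_bound
    (n k t : ℕ) (hk : 0 < k) (hkn : k ≤ n) (hkt : k ≤ t) (htn : t ≤ n)
    (μ : Finset (Fin n) → ℝ)
    (hμ0 : ∀ S, 0 ≤ μ S)
    (hμcard : ∀ S : Finset (Fin n), S.card ≠ k → μ S = 0)
    (hμ1 : ∑ S : Finset (Fin n), μ S = 1)
    (S₀ : Finset (Fin n)) (hS₀card : S₀.card = k) (hS₀pos : 0 < μ S₀)
    (θ : ℝ) (hθ : 0 < θ) :
    (∑ S ∈ Finset.univ.filter (fun S : Finset (Fin n) => μ S ≤ θ),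
        (1 / (Nat.choose (n - k) (t - k) : ℝ)) *
          ∑ T ∈ Finset.powersetCard (t - k) (Finset.univ \ S₀),
            (if S ⊆ S₀ ∪ T then
              μ S / (∑ S' ∈ Finset.powersetCard k (S₀ ∪ T), μ S') else 0)) ≤
      2 ^ n * θ / μ S₀ := by
  have hc : (0 : ℝ) < (Nat.choose (n - k) (t - k) : ℝ) := by
    exact_mod_cast Nat.choose_pos (Nat.sub_le_sub_right htn k)
  have hq : 0 ≤ θ / μ S₀ := by positivity
  have key : ∀ S ∈ Finset.univ.filter (fun S : Finset (Fin n) => μ S ≤ θ),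
      (1 / (Nat.choose (n - k) (t - k) : ℝ)) *
          ∑ T ∈ Finset.powersetCard (t - k) (Finset.univ \ S₀),
            (if S ⊆ S₀ ∪ T then
              μ S / (∑ S' ∈ Finset.powersetCard k (S₀ ∪ T), μ S') else 0) ≤ θ / μ S₀ := by
    intro S hS
    have hSθ : μ S ≤ θ := (Finset.mem_filter.mp hS).2
    have h1 : ∑ T ∈ Finset.powersetCard (t - k) (Finset.univ \ S₀),
            (if S ⊆ S₀ ∪ T then
              μ S / (∑ S' ∈ Finset.powersetCard k (S₀ ∪ T), μ S') else 0)
        ≤ ∑ _T ∈ Finset.powersetCard (t - k) (Finset.univ \ S₀), θ / μ S₀ := by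
      apply Finset.sum_le_sum
      intro T _
      split_ifs with h
      · have h2 : μ S₀ ≤ ∑ S' ∈ Finset.powersetCard k (S₀ ∪ T), μ S' :=
          Finset.single_le_sum (f := μ) (fun i _ => hμ0 i)
            (Finset.mem_powersetCard.mpr ⟨Finset.subset_union_left, hS₀card⟩)
        exact div_le_div₀ hθ.le hSθ hS₀pos h2
      · exact hq
    have hcard : (Finset.univ \ S₀).card = n - k := by
      rw [Finset.card_sdiff_of_subset (Finset.subset_univ _), hS₀card]
      simp
    rw [Finset.sum_const, Finset.card_powersetCard, hcard, nsmul_eq_mul] at h1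
    rw [one_div, inv_mul_le_iff₀ hc]
    exact h1
  refine (Finset.sum_le_sum key).trans ?_
  rw [Finset.sum_const, nsmul_eq_mul, mul_div_assoc]
  apply mul_le_mul_of_nonneg_right _ hq
  have h3 := Finset.card_filter_le (Finset.univ : Finset (Finset (Fin n))) (fun S => μ S ≤ θ)
  have h4 : (Finset.univ : Finset (Finset (Fin n))).card = 2 ^ n := by simp
  rw [h4] at h3
  exact_mod_cast h3
end
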